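/- arXiv:2110.04813 — 15 statements merged into one kernel-verified Lean document; each statement's English description precedes it below -/
import Mathlib

section
/- Let F be a field of characteristic zero, let n ≥ 2 and ℓ ≥ 1 be integers, and set u = ℓ/n ∈ F. Let f ∈ F[x] and define polynomials P_m ∈ F[x] recursively by P_1 = u·f′ and (m+1)·P_{m+1} = P_m′·f + (u − m)·P_m·f′ for m ≥ 1. Let A be a commutative F-algebra, δ : A → A an F-linear derivation, and X, Y ∈ A be elements such that δ(X) = 1, Y is a unit of A, f(X) is a unit of A, and Y^n = f(X). Then for every m ≥ 1 one has f(X)^m · δ^m(Y^ℓ) = m! · Y^ℓ · P_m(X), where δ^m denotes the m-fold iterate of δ. -/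
open Polynomial

/-- A derivation satisfies `a · δ(a^k) = k · a^k · δ a`, without truncated exponents. -/
theorem Derivation.mul_map_pow {R A : Type*} [CommRing R] [CommRing A] [Algebra R A]
    (δ : Derivation R A A) (a : A) (k : ℕ) :
    a * δ (a ^ k) = k * (a ^ k * δ a) := by
  cases k with
  | zero => simp
  | succ k =>
    simp only [Derivation.leibniz_pow, smul_eq_mul, nsmul_eq_mul, Nat.add_sub_cancel]
    ring

/-- For the atomic Hasse inflection polynomials `P m` attached to a
superelliptic presentation `y^n = f(x)` with `u = ℓ/n`, one has
`f(X)^m · δ^m(Y^ℓ) = m! · Y^ℓ · P_m(X)` for any derivation `δ` with `δ X = 1`. -/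
theorem superelliptic_hasse_derivative_formula
    (F : Type*) [Field F] [CharZero F]
    (n ℓ : ℕ) (hn : 2 ≤ n) (hℓ : 1 ≤ ℓ)
    (u : F) (hu : u = (ℓ : F) / (n : F))
    (f : F[X])
    (P : ℕ → F[X])
    (hP1 : P 1 = C u * derivative f)
    (hPrec : ∀ m : ℕ, 1 ≤ m →
      C ((m : F) + 1) * P (m + 1) =
        derivative (P m) * f + C (u - (m : F)) * (P m * derivative f))
    (A : Type*) [CommRing A] [Algebra F A]
    (δ : Derivation F A A)
    (Xa Ya : A)
    (hX : δ Xa = 1)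
    (hY : IsUnit Ya)
    (hfX : IsUnit (aeval Xa f))
    (hYn : Ya ^ n = aeval Xa f) :
    ∀ m : ℕ, 1 ≤ m →
      (aeval Xa f) ^ m * (⇑δ)^[m] (Ya ^ ℓ) =
        (m.factorial : A) * (Ya ^ ℓ * aeval Xa (P m)) := by
  have hδ (p : F[X]) : δ (aeval Xa p) = aeval Xa (derivative p) := by
    rw [Derivation.map_aeval, hX, smul_eq_mul, mul_one]
  have hn0 : (n : F) ≠ 0 := by
    exact_mod_cast (by lia : n ≠ 0)
  have hnA : IsUnit (n : A) := by
    simpa using (IsUnit.mk0 (n : F) hn0).map (algebraMap F A)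
  have hnu : (n : A) * algebraMap F A u = ℓ := by
    rw [← map_natCast (algebraMap F A) n, ← map_mul, hu, mul_div_cancel₀ _ hn0, map_natCast]
  have hYδ : n * (aeval Xa f * δ Ya) = Ya * aeval Xa (derivative f) := by
    rw [← hδ, ← hYn, Derivation.mul_map_pow]
  have hW : aeval Xa f * δ (Ya ^ ℓ) =
      algebraMap F A u * (Ya ^ ℓ * aeval Xa (derivative f)) := by
    apply (hnA.mul hY).mul_left_cancel
    linear_combination n * aeval Xa f * δ.mul_map_pow Ya ℓ + ℓ * Ya ^ ℓ * hYδ -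
      Ya * Ya ^ ℓ * aeval Xa (derivative f) * hnu
  intro m hm
  induction m, hm using Nat.le_induction with
  | base =>
    simp only [pow_one, Function.iterate_one, Nat.factorial_one, Nat.cast_one, one_mul, hP1,
      map_mul, aeval_C, hW]
    ring
  | succ m hm ih =>
    have hrec := congrArg (aeval Xa) (hPrec m hm)
    simp only [map_mul, map_add, map_sub, aeval_C, map_natCast, map_one] at hrec
    have hih := congrArg δ ih
    simp only [Derivation.leibniz, Derivation.map_natCast, smul_eq_mul, hδ, mul_zero,
      add_zero] at hih
    have hfm := δ.mul_map_pow (aeval Xa f) m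
    rw [hδ] at hfm
    rw [Function.iterate_succ_apply', Nat.factorial_succ]
    push_cast
    linear_combination aeval Xa f * hih - (⇑δ)^[m] (Ya ^ ℓ) * hfm -
      m * aeval Xa (derivative f) * ih + m.factorial * aeval Xa (P m) * hW -
      m.factorial * Ya ^ ℓ * hrec
end

section
/- Let F be a field of characteristic zero, u ∈ F, a ≥ 1 an integer, and let f = x^a·(x−1)^a·(x−λ)^a ∈ F[x, λ]. Let P_m ∈ F[x, λ] (m ≥ 1) be the atomic inflection polynomials attached to (f, u). Then for every m ≥ 1 the polynomial identity P_m(x+1, λ+1) = (−1)^{(a+1)·m} · P_m(−x, −λ) holds in F[x, λ], where P_m(x+1, λ+1) and P_m(−x, −λ) denote the images of P_m under the F-algebra endomorphisms of F[x, λ] sending (x, λ) to (x+1, λ+1) and to (−x, −λ) respectively. -/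
open MvPolynomial

/-- Chain rule for a substitution whose `i`-th partial derivative is `c` in the `i`-th coordinate
and zero in all others. -/
theorem MvPolynomial.pderiv_aeval_of_pderiv_eq_single {R σ : Type*} [CommRing R] [DecidableEq σ]
    (i : σ) (c : R) (g : σ → MvPolynomial σ R)
    (hg : ∀ j, pderiv i (g j) = C c * Pi.single (M := fun _ => MvPolynomial σ R) i 1 j)
    (p : MvPolynomial σ R) :
    pderiv i (aeval g p) = C c * aeval g (pderiv i p) := by
  induction p using MvPolynomial.induction_on with
  | C r => simp [MvPolynomial.algebraMap_eq]
  | add p q hp hq => simp only [map_add, hp, hq, mul_add]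
  | mul_X p j hp =>
    have hs : aeval g (Pi.single (M := fun _ => MvPolynomial σ R) i 1 j) =
        Pi.single (M := fun _ => MvPolynomial σ R) i 1 j := by
      by_cases h : j = i
      · subst h; simp
      · simp [h]
    simp only [map_mul, aeval_X, Derivation.leibniz, smul_eq_mul, map_add, hp, hg, pderiv_X, hs]
    ring

/-- The atomic inflection polynomials of the superelliptic Legendre
pencil `y^n = x^a (x-1)^a (x-λ)^a` satisfy the translation symmetry
`P_m(x+1, λ+1) = (-1)^{(a+1)m} · P_m(-x, -λ)`. -/
theorem legendre_inflection_translation_symmetry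
    (F : Type*) [Field F] [CharZero F]
    (u : F) (a : ℕ) (ha : 1 ≤ a)
    (f : MvPolynomial (Fin 2) F)
    (hf : f = (X 0) ^ a * (X 0 - 1) ^ a * (X 0 - X 1) ^ a)
    (P : ℕ → MvPolynomial (Fin 2) F)
    (hP1 : P 1 = C u * pderiv 0 f)
    (hPrec : ∀ m : ℕ, 1 ≤ m →
      C ((m : F) + 1) * P (m + 1) =
        pderiv 0 (P m) * f + C (u - (m : F)) * (P m * pderiv 0 f)) :
    ∀ m : ℕ, 1 ≤ m →
      aeval (fun i : Fin 2 => X i + 1) (P m) =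
        C ((-1 : F) ^ ((a + 1) * m)) * aeval (fun i : Fin 2 => - X i) (P m) := by
  have hCu : ∀ (g : Fin 2 → MvPolynomial (Fin 2) F) (r : F), aeval g (C r) = C r := by
    intro g r
    rw [aeval_C, MvPolynomial.algebraMap_eq]
  set T := aeval (R := F) (fun i : Fin 2 => (X i + 1 : MvPolynomial (Fin 2) F)) with hT
  set N := aeval (R := F) (fun i : Fin 2 => (-X i : MvPolynomial (Fin 2) F)) with hN
  have hTd : ∀ p, pderiv 0 (T p) = T (pderiv 0 p) := by
    intro p
    have h := pderiv_aeval_of_pderiv_eq_single (0 : Fin 2) (1 : F)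
      (fun i => X i + 1) (by intro j; simp [pderiv_X]) p
    simpa only [map_neg, map_one, one_mul, neg_mul] using h
  have hNd : ∀ p, pderiv 0 (N p) = -N (pderiv 0 p) := by
    intro p
    have h := pderiv_aeval_of_pderiv_eq_single (0 : Fin 2) (-1 : F)
      (fun i => -X i) (by intro j; simp [pderiv_X]) p
    simpa only [map_neg, map_one, one_mul, neg_mul] using h
  have hsymm : ∀ (k : ℕ) (p : MvPolynomial (Fin 2) F), T p = C ((-1 : F) ^ k) * N p →
      T (pderiv 0 p) = C ((-1 : F) ^ (k + 1)) * N (pderiv 0 p) := by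
    intro k p h
    rw [← hTd, h, pderiv_C_mul, hNd, pow_succ]
    simp
  have hf' : T f = C ((-1 : F) ^ a) * N f := by
    simp only [hf, hT, hN, map_mul, map_pow, map_sub, aeval_X, map_one, map_neg]
    simp only [← mul_pow]
    congr 1
    ring
  have hdf := hsymm a f hf'
  intro m hm
  induction m, hm using Nat.le_induction with
  | base =>
    rw [hP1, map_mul, map_mul, hCu, hCu, hdf, mul_one]
    ring
  | succ m hm ih =>
    have hne : (C ((m : F) + 1) : MvPolynomial (Fin 2) F) ≠ 0 := by
      rw [Ne, C_eq_zero]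
      exact Nat.cast_add_one_ne_zero m
    have hTC : ∀ r : F, T (C r) = C r := hCu _
    have hNC : ∀ r : F, N (C r) = C r := hCu _
    have hTm := congrArg T (hPrec m hm)
    have hNm := congrArg N (hPrec m hm)
    rw [map_mul T, hTC, map_add T, map_mul T, map_mul T, map_mul T, hTC, hsymm _ _ ih, ih, hf', hdf] at hTm
    rw [map_mul N, hNC, map_add N, map_mul N, map_mul N, map_mul N, hNC] at hNm
    apply mul_left_cancel₀ hne
    rw [mul_left_comm, hTm, hNm]
    simp only [map_pow, map_neg, map_one]
    ring
end

section
/- Let F be a field of characteristic zero, u ∈ F, a ≥ 1 an integer, and let f = x^a·(x−1)^a·(x−λ)^a ∈ F[x, λ]. Let P_m ∈ F[x, λ] (m ≥ 1) be the atomic inflection polynomials attached to (f, u). Then for every m ≥ 1 and all natural numbers i, j, k with i + j + k = m·(3a − 1), the coefficient of x^i·λ^j in P_m equals the coefficient of x^i·λ^k in P_m. -/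
open MvPolynomial

namespace SymmetricHomogenization

variable {F : Type*} [Field F]

/-- Setting the homogenizing variable to `1`. -/
noncomputable def dehomogenize : MvPolynomial (Fin 3) F →ₐ[F] MvPolynomial (Fin 2) F :=
  aeval ![X 0, X 1, 1]

/-- `p` is the dehomogenization of a form of degree `d` that is invariant under exchanging the
last two variables. -/
def HasSymmetricHomogenization (d : ℕ) (p : MvPolynomial (Fin 2) F) : Prop :=
  ∃ Q : MvPolynomial (Fin 3) F, Q.IsHomogeneous d ∧
    rename (Equiv.swap (1 : Fin 3) 2) Q = Q ∧ dehomogenize Q = p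

theorem pderiv_dehomogenize (Q : MvPolynomial (Fin 3) F) :
    pderiv 0 (dehomogenize Q) = dehomogenize (pderiv 0 Q) := by
  induction Q using MvPolynomial.induction_on with
  | C c => simp [dehomogenize]
  | add p q hp hq => simp [hp, hq]
  | mul_X p i hp =>
    rw [map_mul, pderiv_mul, hp, pderiv_mul, map_add, map_mul, map_mul]
    congr 2
    fin_cases i <;> simp [dehomogenize, pderiv_X]

theorem dehomogenize_monomial (s : Fin 3 →₀ ℕ) (c : F) :
    dehomogenize (monomial s c) =
      monomial (Finsupp.single (0 : Fin 2) (s 0) + Finsupp.single 1 (s 1)) c := by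
  rw [dehomogenize, aeval_monomial, Finsupp.prod_fintype _ _ (by simp), Fin.prod_univ_three,
    ← mul_one c, ← C_mul_monomial, ← one_mul (1 : F), ← monomial_mul]
  simp [X_pow_eq_monomial, algebraMap_eq]

theorem coeff_dehomogenize {Q : MvPolynomial (Fin 3) F} {i j k : ℕ}
    (hQ : Q.IsHomogeneous (i + j + k)) :
    coeff (Finsupp.single (0 : Fin 2) i + Finsupp.single 1 j) (dehomogenize Q) =
      coeff (Finsupp.equivFunOnFinite.symm ![i, j, k]) Q := by
  conv_lhs => rw [Q.as_sum]
  conv_rhs => rw [Q.as_sum]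
  simp only [map_sum, coeff_sum, dehomogenize_monomial, coeff_monomial]
  refine Finset.sum_congr rfl fun s hs => ?_
  have hd := hQ (mem_support_iff.mp hs)
  rw [Finsupp.weight_apply, Finsupp.sum_fintype _ _ (by simp), Fin.sum_univ_three] at hd
  simp only [Pi.one_apply, smul_eq_mul, mul_one] at hd
  congr 1
  simp only [Finsupp.ext_iff, Fin.forall_fin_succ, eq_iff_iff]
  simp
  omega

theorem HasSymmetricHomogenization.coeff_eq {p : MvPolynomial (Fin 2) F} {i j k : ℕ}
    (h : HasSymmetricHomogenization (i + j + k) p) :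
    coeff (Finsupp.single (0 : Fin 2) i + Finsupp.single 1 j) p =
      coeff (Finsupp.single (0 : Fin 2) i + Finsupp.single 1 k) p := by
  obtain ⟨Q, hQ, hs, rfl⟩ := h
  have hQ' : Q.IsHomogeneous (i + k + j) := by rwa [add_right_comm]
  rw [coeff_dehomogenize hQ, coeff_dehomogenize hQ']
  conv_rhs => rw [← hs]
  rw [← coeff_rename_mapDomain _ (Equiv.swap (1 : Fin 3) 2).injective]
  congr 1
  ext t
  rw [← Finsupp.equivMapDomain_eq_mapDomain, Finsupp.equivMapDomain_apply]
  fin_cases t <;> simp [Equiv.swap_apply_def]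

theorem HasSymmetricHomogenization.add {d : ℕ} {p q : MvPolynomial (Fin 2) F}
    (hp : HasSymmetricHomogenization d p) (hq : HasSymmetricHomogenization d q) :
    HasSymmetricHomogenization d (p + q) := by
  obtain ⟨P, hP, hPs, rfl⟩ := hp
  obtain ⟨Q, hQ, hQs, rfl⟩ := hq
  exact ⟨P + Q, hP.add hQ, by rw [map_add, hPs, hQs], map_add _ _ _⟩

theorem HasSymmetricHomogenization.mul {d e : ℕ} {p q : MvPolynomial (Fin 2) F}
    (hp : HasSymmetricHomogenization d p) (hq : HasSymmetricHomogenization e q) :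
    HasSymmetricHomogenization (d + e) (p * q) := by
  obtain ⟨P, hP, hPs, rfl⟩ := hp
  obtain ⟨Q, hQ, hQs, rfl⟩ := hq
  exact ⟨P * Q, hP.mul hQ, by rw [map_mul, hPs, hQs], map_mul _ _ _⟩

theorem HasSymmetricHomogenization.C_mul {d : ℕ} {p : MvPolynomial (Fin 2) F} (c : F)
    (hp : HasSymmetricHomogenization d p) : HasSymmetricHomogenization d (C c * p) := by
  obtain ⟨P, hP, hPs, rfl⟩ := hp
  exact ⟨C c * P, hP.C_mul c, by rw [map_mul, hPs, rename_C], by simp [dehomogenize]⟩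

theorem HasSymmetricHomogenization.pderiv_zero {d : ℕ} {p : MvPolynomial (Fin 2) F}
    (hp : HasSymmetricHomogenization d p) :
    HasSymmetricHomogenization (d - 1) (pderiv 0 p) := by
  obtain ⟨P, hP, hPs, rfl⟩ := hp
  refine ⟨pderiv 0 P, hP.pderiv, ?_, (pderiv_dehomogenize P).symm⟩
  have h := pderiv_rename (Equiv.swap (1 : Fin 3) 2).injective 0 P
  rw [hPs, Equiv.swap_apply_of_ne_of_ne (by decide) (by decide)] at h
  exact h.symm

theorem hasSymmetricHomogenization_legendre (a : ℕ) :
    HasSymmetricHomogenization (3 * a)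
      ((X 0) ^ a * (X 0 - 1) ^ a * (X 0 - X 1) ^ a : MvPolynomial (Fin 2) F) := by
  refine ⟨(X 0) ^ a * (X 0 - X 2) ^ a * (X 0 - X 1) ^ a, ?_, ?_, ?_⟩
  · have h (i : Fin 3) : (X i : MvPolynomial (Fin 3) F).IsHomogeneous 1 := isHomogeneous_X F i
    convert (((h 0).pow a).mul (((h 0).sub (h 2)).pow a)).mul (((h 0).sub (h 1)).pow a) using 1
    ring
  · have h : Equiv.swap (1 : Fin 3) 2 0 = 0 := by decide
    simp only [map_mul, map_pow, map_sub, rename_X, Equiv.swap_apply_left,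
      Equiv.swap_apply_right, h]
    ring
  · simp [dehomogenize]

end SymmetricHomogenization

open SymmetricHomogenization

/-- For the atomic inflection polynomials of the Legendre pencil
`y^n = x^a (x-1)^a (x-λ)^a`, the coefficient of `x^i λ^j` equals the coefficient of
`x^i λ^k` whenever `i + j + k = m(3a-1)` (homogenization symmetry `λ ↔ z`). -/
theorem legendre_inflection_coefficient_symmetry
    (F : Type*) [Field F] [CharZero F]
    (u : F) (a : ℕ) (ha : 1 ≤ a)
    (f : MvPolynomial (Fin 2) F)
    (hf : f = (X 0) ^ a * (X 0 - 1) ^ a * (X 0 - X 1) ^ a)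
    (P : ℕ → MvPolynomial (Fin 2) F)
    (hP1 : P 1 = C u * pderiv 0 f)
    (hPrec : ∀ m : ℕ, 1 ≤ m →
      C ((m : F) + 1) * P (m + 1) =
        pderiv 0 (P m) * f + C (u - (m : F)) * (P m * pderiv 0 f)) :
    ∀ m : ℕ, 1 ≤ m → ∀ i j k : ℕ, i + j + k = m * (3 * a - 1) →
      coeff (Finsupp.single (0 : Fin 2) i + Finsupp.single 1 j) (P m) =
        coeff (Finsupp.single (0 : Fin 2) i + Finsupp.single 1 k) (P m) := by
  have hfs : HasSymmetricHomogenization (3 * a) f := hf ▸ hasSymmetricHomogenization_legendre a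
  have key : ∀ m : ℕ, 1 ≤ m → HasSymmetricHomogenization (m * (3 * a - 1)) (P m) := by
    intro m hm
    induction m, hm using Nat.le_induction with
    | base => rw [hP1, one_mul]; exact hfs.pderiv_zero.C_mul u
    | succ m hm ih =>
      have hne : (m : F) + 1 ≠ 0 := Nat.cast_add_one_ne_zero m
      have hP : P (m + 1) = C ((m : F) + 1)⁻¹ *
          (pderiv 0 (P m) * f + C (u - (m : F)) * (P m * pderiv 0 f)) := by
        rw [← hPrec m hm, ← mul_assoc, ← C_mul, inv_mul_cancel₀ hne, C_1, one_mul]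
      have hpos : 1 ≤ m * (3 * a - 1) := Nat.mul_pos hm (by omega)
      have hdeg : m * (3 * a - 1) - 1 + 3 * a = (m + 1) * (3 * a - 1) := by
        rw [add_mul]; omega
      rw [hP]
      refine ((hdeg ▸ ih.pderiv_zero.mul hfs).add (.C_mul _ ?_)).C_mul _
      rw [add_mul, one_mul]
      exact ih.mul hfs.pderiv_zero
  intro m hm i j k hijk
  exact (hijk ▸ key m hm).coeff_eq
end

section
/- Let F be a field of characteristic zero and let f = x^3 + λ·x + 2 ∈ F[x, λ]. Let P_m ∈ F[x, λ] (m ≥ 1) be the atomic inflection polynomials attached to (f, u) with u = 1/2. Then for every ζ ∈ F with ζ^3 = 1 and every m ≥ 1, the image of P_m under the F-algebra endomorphism of F[x, λ] sending x to ζ·x and λ to ζ^2·λ equals ζ^{2m}·P_m. In particular, each inflectionary curve (P_m = 0) derived from the Weierstrass pencil y^n = x^3 + λx + 2 carries a cyclic μ_3-symmetry given by (x, λ) ↦ (ζx, ζ^{−1}λ). -/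
open MvPolynomial

/-- Chain rule for `∂/∂x` under a diagonal rescaling `(x, λ) ↦ (ax, bλ)`. -/
theorem pderiv_zero_rescale {R : Type*} [CommSemiring R] {a b : R}
    {σ : MvPolynomial (Fin 2) R →ₐ[R] MvPolynomial (Fin 2) R}
    (h0 : σ (X 0) = C a * X 0) (h1 : σ (X 1) = C b * X 1) (p : MvPolynomial (Fin 2) R) :
    pderiv 0 (σ p) = C a * σ (pderiv 0 p) := by
  induction p using MvPolynomial.induction_on with
  | C r =>
    have hC : σ (C r) = C r := σ.commutes r
    rw [hC, pderiv_C, map_zero, mul_zero]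
  | add p q hp hq => simp only [map_add, hp, hq, mul_add]
  | mul_X p i hp =>
    fin_cases i
    · simp [Derivation.leibniz, hp, h0]
      ring
    · simp [Derivation.leibniz, hp, h1]
      ring

/-- The inflection polynomials of the Weierstrass pencil
`y^n = x^3 + λx + 2` (with `u = 1/2`) satisfy `P_m(ζx, ζ²λ) = ζ^{2m} · P_m(x, λ)`
for any cube root of unity `ζ`: the inflectionary curves carry a μ₃-symmetry. -/
theorem weierstrass_inflectionary_mu3_symmetry
    (F : Type*) [Field F] [CharZero F]
    (f : MvPolynomial (Fin 2) F)
    (hf : f = X 0 ^ 3 + X 1 * X 0 + C 2)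
    (P : ℕ → MvPolynomial (Fin 2) F)
    (hP1 : P 1 = C (1 / 2 : F) * pderiv 0 f)
    (hPrec : ∀ m : ℕ, 1 ≤ m →
      C ((m : F) + 1) * P (m + 1) =
        pderiv 0 (P m) * f + C ((1 / 2 : F) - (m : F)) * (P m * pderiv 0 f)) :
    ∀ ζ : F, ζ ^ 3 = 1 → ∀ m : ℕ, 1 ≤ m →
      aeval ![C ζ * X 0, C (ζ ^ 2) * X 1] (P m) = C (ζ ^ (2 * m)) * P m := by
  intro ζ hζ
  obtain ⟨σ, hσ⟩ : ∃ σ : MvPolynomial (Fin 2) F →ₐ[F] MvPolynomial (Fin 2) F,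
      aeval ![C ζ * X 0, C (ζ ^ 2) * X 1] = σ := ⟨_, rfl⟩
  rw [hσ]
  have hC : (C ζ : MvPolynomial (Fin 2) F) ^ 3 = 1 := by rw [← C_pow, hζ, C_1]
  have hσC (r : F) : σ (C r) = C r := σ.commutes r
  have h0 : σ (X 0) = C ζ * X 0 := by simp [← hσ]
  have h1 : σ (X 1) = C (ζ ^ 2) * X 1 := by simp [← hσ]
  have hσf : σ f = f := by
    rw [hf, map_add, map_add, map_mul, map_pow, hσC, h0, h1, C_pow]
    linear_combination (X 0 ^ 3 + X 1 * X 0) * hC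
  have hσd (p : MvPolynomial (Fin 2) F) : σ (pderiv 0 p) = C ζ ^ 2 * pderiv 0 (σ p) := by
    rw [pderiv_zero_rescale h0 h1]
    linear_combination -σ (pderiv 0 p) * hC
  intro m hm
  induction m, hm using Nat.le_induction with
  | base =>
    rw [hP1, map_mul, hσC, hσd, hσf, C_pow]
    ring
  | succ m hm ih =>
    have hne : (C ((m : F) + 1) : MvPolynomial (Fin 2) F) ≠ 0 := by
      rw [Ne, C_eq_zero]
      exact Nat.cast_add_one_ne_zero m
    apply mul_left_cancel₀ hne
    have h := congrArg σ (hPrec m hm)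
    simp only [map_add σ, map_mul σ, hσC, hσd, hσf, ih, pderiv_C_mul] at h
    rw [h]
    simp only [C_pow]
    linear_combination -(C ζ ^ (2 * (m + 1))) * hPrec m hm
end

section
/- Let F be a field of characteristic zero, u ∈ F, and let a, b, c be positive integers. Let f = x^a·(x−1)^b·(x−λ)^c ∈ F[x, λ] and let P_m ∈ F[x, λ] (m ≥ 1) be the atomic inflection polynomials attached to (f, u). Then for every m ≥ 1 and every pair of natural numbers (i, j) such that the coefficient of x^i·λ^j in P_m is nonzero, one has j ≤ m·c and m·(a + c − 1) ≤ i + j ≤ m·(a + b + c − 1). Equivalently, the support of P_m is contained in the convex quadrilateral with vertices (m(a+c)−m, 0), (m(a+b+c)−m, 0), (ma−m, mc) and (m(a+b)−m, mc). -/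
open MvPolynomial

/-- The exponents `s` of two variables with `s 1 ≤ d` and `lo ≤ s 0 + s 1 ≤ hi`. -/
def exponentBand (d lo hi : ℕ) : Set (Fin 2 →₀ ℕ) :=
  {s | s 1 ≤ d ∧ lo ≤ s 0 + s 1 ∧ s 0 + s 1 ≤ hi}

section

variable {R : Type*} [CommRing R]

theorem mem_restrictSupport_exponentBand {p : MvPolynomial (Fin 2) R} {d lo hi : ℕ} :
    p ∈ restrictSupport R (exponentBand d lo hi) ↔
      ∀ s, coeff s p ≠ 0 → s 1 ≤ d ∧ lo ≤ s 0 + s 1 ∧ s 0 + s 1 ≤ hi := by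
  simp only [mem_restrictSupport_iff, Set.subset_def, Finset.mem_coe, mem_support_iff,
    exponentBand, Set.mem_ofPred_eq]

theorem mul_mem_restrictSupport_exponentBand {p q : MvPolynomial (Fin 2) R}
    {d lo hi d' lo' hi' : ℕ} (hp : p ∈ restrictSupport R (exponentBand d lo hi))
    (hq : q ∈ restrictSupport R (exponentBand d' lo' hi')) :
    p * q ∈ restrictSupport R (exponentBand (d + d') (lo + lo') (hi + hi')) := by
  rw [mem_restrictSupport_exponentBand] at *
  intro s hs
  obtain ⟨s₁, h₁, s₂, h₂, rfl⟩ := Finset.mem_add.mp (support_mul p q (mem_support_iff.mpr hs))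
  have := hp s₁ (mem_support_iff.mp h₁)
  have := hq s₂ (mem_support_iff.mp h₂)
  simp only [Finsupp.add_apply]
  omega

theorem one_mem_restrictSupport_exponentBand (d hi : ℕ) :
    (1 : MvPolynomial (Fin 2) R) ∈ restrictSupport R (exponentBand d 0 hi) := by
  rw [mem_restrictSupport_exponentBand]
  intro s hs
  rw [coeff_one] at hs
  obtain rfl : 0 = s := by by_contra h; simp [h] at hs
  simp

theorem pow_mem_restrictSupport_exponentBand {p : MvPolynomial (Fin 2) R} {d lo hi : ℕ}
    (hp : p ∈ restrictSupport R (exponentBand d lo hi)) (n : ℕ) :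
    p ^ n ∈ restrictSupport R (exponentBand (n * d) (n * lo) (n * hi)) := by
  induction n with
  | zero => simpa using one_mem_restrictSupport_exponentBand (R := R) 0 0
  | succ n ih =>
    simpa only [pow_succ, add_one_mul] using mul_mem_restrictSupport_exponentBand ih hp

theorem X_zero_mem_restrictSupport_exponentBand {d lo hi : ℕ} (hlo : lo ≤ 1) (hhi : 1 ≤ hi) :
    (X 0 : MvPolynomial (Fin 2) R) ∈ restrictSupport R (exponentBand d lo hi) := by
  rw [mem_restrictSupport_exponentBand]
  intro s hs
  rw [coeff_X] at hs
  obtain rfl : Finsupp.single 0 1 = s := by by_contra h; simp [h] at hs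
  simp [hlo, hhi]

theorem X_one_mem_restrictSupport_exponentBand :
    (X 1 : MvPolynomial (Fin 2) R) ∈ restrictSupport R (exponentBand 1 1 1) := by
  rw [mem_restrictSupport_exponentBand]
  intro s hs
  rw [coeff_X] at hs
  obtain rfl : Finsupp.single 1 1 = s := by by_contra h; simp [h] at hs
  simp

theorem pderiv_zero_mem_restrictSupport_exponentBand {p : MvPolynomial (Fin 2) R} {d lo hi : ℕ}
    (hp : p ∈ restrictSupport R (exponentBand d lo hi)) :
    pderiv 0 p ∈ restrictSupport R (exponentBand d (lo - 1) (hi - 1)) := by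
  rw [mem_restrictSupport_exponentBand] at *
  intro s hs
  rw [coeff_pderiv] at hs
  have := hp _ (left_ne_zero_of_mul hs)
  simp at this
  omega

theorem C_mul_mem_restrictSupport {σ : Type*} {t : Set (σ →₀ ℕ)} {p : MvPolynomial σ R}
    (hp : p ∈ restrictSupport R t) (r : R) : C r * p ∈ restrictSupport R t := by
  rw [C_mul']
  exact Submodule.smul_mem _ r hp

/-- The product `x ^ a * (x - 1) ^ b * (x - y) ^ c` has `y`-degree at most `c` and total degrees
between `a + c` and `a + b + c`. -/
theorem legendre_mem_restrictSupport_exponentBand (a b c : ℕ) :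
    (X 0 ^ a * (X 0 - 1) ^ b * (X 0 - X 1) ^ c : MvPolynomial (Fin 2) R) ∈
      restrictSupport R (exponentBand c (a + c) (a + b + c)) := by
  have hx := pow_mem_restrictSupport_exponentBand
    (X_zero_mem_restrictSupport_exponentBand (R := R) (d := 0) le_rfl le_rfl) a
  have hx1 := pow_mem_restrictSupport_exponentBand (Submodule.sub_mem _
    (X_zero_mem_restrictSupport_exponentBand (R := R) (d := 0) zero_le_one le_rfl)
    (one_mem_restrictSupport_exponentBand 0 1)) b
  have hxy := pow_mem_restrictSupport_exponentBand (Submodule.sub_mem _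
    (X_zero_mem_restrictSupport_exponentBand (R := R) le_rfl le_rfl)
    X_one_mem_restrictSupport_exponentBand) c
  simpa using mul_mem_restrictSupport_exponentBand
    (mul_mem_restrictSupport_exponentBand hx hx1) hxy

end

/-- The support of the atomic inflection polynomial `P_m` of the
Legendre pencil `y^n = x^a (x-1)^b (x-λ)^c` is contained in the quadrilateral with
vertices `(m(a+c)-m, 0)`, `(m(a+b+c)-m, 0)`, `(ma-m, mc)`, `(m(a+b)-m, mc)`:
explicitly, `j ≤ mc` and `m(a+c-1) ≤ i+j ≤ m(a+b+c-1)` for every `(i,j)` in the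
support. -/
theorem legendre_inflection_support_bound
    (F : Type*) [Field F] [CharZero F]
    (u : F) (a b c : ℕ) (ha : 1 ≤ a) (hb : 1 ≤ b) (hc : 1 ≤ c)
    (f : MvPolynomial (Fin 2) F)
    (hf : f = (X 0) ^ a * (X 0 - 1) ^ b * (X 0 - X 1) ^ c)
    (P : ℕ → MvPolynomial (Fin 2) F)
    (hP1 : P 1 = C u * pderiv 0 f)
    (hPrec : ∀ m : ℕ, 1 ≤ m →
      C ((m : F) + 1) * P (m + 1) =
        pderiv 0 (P m) * f + C (u - (m : F)) * (P m * pderiv 0 f)) :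
    ∀ m : ℕ, 1 ≤ m → ∀ i j : ℕ,
      coeff (Finsupp.single (0 : Fin 2) i + Finsupp.single 1 j) (P m) ≠ 0 →
      j ≤ m * c ∧ m * (a + c - 1) ≤ i + j ∧ i + j ≤ m * (a + b + c - 1) := by
  have hfB : f ∈ restrictSupport F (exponentBand c (a + c) (a + b + c)) :=
    hf ▸ legendre_mem_restrictSupport_exponentBand a b c
  have hdf := pderiv_zero_mem_restrictSupport_exponentBand hfB
  have hP : ∀ m, 1 ≤ m → P m ∈ restrictSupport F
      (exponentBand (m * c) (m * (a + c - 1)) (m * (a + b + c - 1))) := by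
    intro m hm
    induction m, hm using Nat.le_induction with
    | base =>
      simpa only [hP1, one_mul] using C_mul_mem_restrictSupport hdf u
    | succ m hm ih =>
      have hm0 : ((m : F) + 1) ≠ 0 := Nat.cast_add_one_ne_zero m
      have hP_eq : P (m + 1) = C ((m : F) + 1)⁻¹ * (C ((m : F) + 1) * P (m + 1)) := by
        rw [← mul_assoc, ← C_mul, inv_mul_cancel₀ hm0, C_1, one_mul]
      have hlo : 1 ≤ m * (a + c - 1) := Nat.mul_pos hm (by omega)
      have hhi : 1 ≤ m * (a + b + c - 1) := Nat.mul_pos hm (by omega)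
      have hleft := mul_mem_restrictSupport_exponentBand
        (pderiv_zero_mem_restrictSupport_exponentBand ih) hfB
      rw [show m * (a + c - 1) - 1 + (a + c) = m * (a + c - 1) + (a + c - 1) by omega,
        show m * (a + b + c - 1) - 1 + (a + b + c) =
          m * (a + b + c - 1) + (a + b + c - 1) by omega] at hleft
      rw [hP_eq, hPrec m hm]
      simp only [add_one_mul]
      exact C_mul_mem_restrictSupport (Submodule.add_mem _ hleft
        (C_mul_mem_restrictSupport (mul_mem_restrictSupport_exponentBand ih hdf) _)) _
  intro m hm i j hij
  simpa using mem_restrictSupport_exponentBand.mp (hP m hm) _ hij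
end

section
/- Let F be a field of characteristic zero, u ∈ F, and let a, b, c be positive integers. Let f = x^a·(x−1)^b·(x−λ)^c ∈ F[x, λ] and let P_m ∈ F[x, λ] (m ≥ 1) be the atomic inflection polynomials attached to (f, u). Then for every m ≥ 1: (i) the coefficient of x^{m(a+c)−m} (i.e., of x^{m(a+c)−m}·λ^0) in P_m equals ((−1)^{bm}/m!)·((a+c)u)_m; (ii) the coefficient of x^{m(a+b+c)−m} in P_m equals (1/m!)·((a+b+c)u)_m; (iii) the coefficient of x^{ma−m}·λ^{mc} in P_m equals ((−1)^{(b+c)m}/m!)·(au)_m; and (iv) the coefficient of x^{m(a+b)−m}·λ^{mc} in P_m equals ((−1)^{cm}/m!)·((a+b)u)_m. Here au, (a+b)u, (a+c)u and (a+b+c)u denote the products in F of the indicated positive integers with u. -/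
open MvPolynomial

/-- The falling factorial `w(w-1)⋯(w-k+1)` of an element of a field. -/
def fallingFactorial {F : Type*} [Field F] (w : F) (k : ℕ) : F :=
  ∏ i ∈ Finset.range k, (w - i)

section ExtremalMonomial

variable {σ R G : Type*} [CommRing R] [AddCommGroup G] [PartialOrder G]

/-- All exponents of `p` have `φ`-value at most `φ d`, and `k` is the coefficient of `p` at `d`. -/
def HasExtremalCoeff (φ : (σ →₀ ℕ) →+ G) (d : σ →₀ ℕ) (k : R) (p : MvPolynomial σ R) : Prop :=
  (∀ e, coeff e p ≠ 0 → φ e ≤ φ d) ∧ coeff d p = k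

namespace HasExtremalCoeff

variable {φ : (σ →₀ ℕ) →+ G} {d d' : σ →₀ ℕ} {k k' : R} {p q : MvPolynomial σ R}

protected theorem one : HasExtremalCoeff φ 0 (1 : R) 1 := by
  classical
  refine ⟨fun e he => ?_, coeff_zero_one⟩
  rw [coeff_one] at he
  rw [show e = 0 by by_contra h; exact he (if_neg (Ne.symm h))]

protected theorem X (i : σ) : HasExtremalCoeff φ (Finsupp.single i 1) (1 : R) (X i) := by
  classical
  refine ⟨fun e he => ?_, by rw [coeff_X, if_pos rfl]⟩
  rw [coeff_X] at he
  rw [show e = Finsupp.single i 1 by by_contra h; exact he (if_neg (Ne.symm h))]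

protected theorem add (hp : HasExtremalCoeff φ d k p) (hq : HasExtremalCoeff φ d k' q) :
    HasExtremalCoeff φ d (k + k') (p + q) := by
  refine ⟨fun e he => ?_, by rw [coeff_add, hp.2, hq.2]⟩
  by_cases h : coeff e p = 0
  · exact hq.1 e fun h' => he (by rw [coeff_add, h, h', add_zero])
  · exact hp.1 e h

protected theorem C_mul (r : R) (hp : HasExtremalCoeff φ d k p) :
    HasExtremalCoeff φ d (r * k) (C r * p) := by
  refine ⟨fun e he => hp.1 e fun h => he (by rw [coeff_C_mul, h, mul_zero]), ?_⟩
  rw [coeff_C_mul, hp.2]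

protected theorem neg (hp : HasExtremalCoeff φ d k p) : HasExtremalCoeff φ d (-k) (-p) := by
  simpa using hp.C_mul (-1)

/-- The extremal coefficient vanishes at every exponent strictly above the extremal one. -/
theorem zero_of_lt (hp : HasExtremalCoeff φ d k p) (h : φ d < φ d') :
    HasExtremalCoeff φ d' 0 p := by
  refine ⟨fun e he => (hp.1 e he).trans h.le, ?_⟩
  by_contra h'
  exact (hp.1 d' h').not_gt h

variable [IsOrderedAddMonoid G]

protected theorem mul (hφ : Function.Injective φ) (hp : HasExtremalCoeff φ d k p)
    (hq : HasExtremalCoeff φ d' k' q) : HasExtremalCoeff φ (d + d') (k * k') (p * q) := by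
  classical
  constructor
  · intro e he
    rw [coeff_mul] at he
    obtain ⟨⟨x, y⟩, hxy, hne⟩ := Finset.exists_ne_zero_of_sum_ne_zero he
    rw [Finset.HasAntidiagonal.mem_antidiagonal] at hxy
    rw [← hxy, map_add, map_add]
    exact add_le_add (hp.1 x (left_ne_zero_of_mul hne)) (hq.1 y (right_ne_zero_of_mul hne))
  · rw [coeff_mul, Finset.sum_eq_single (d, d'), hp.2, hq.2]
    · rintro ⟨x, y⟩ hxy hne
      rw [Finset.HasAntidiagonal.mem_antidiagonal] at hxy
      by_contra h
      have hx := hp.1 x (left_ne_zero_of_mul h)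
      have hy := hq.1 y (right_ne_zero_of_mul h)
      have hsum : φ x + φ y = φ d + φ d' := by rw [← map_add, ← map_add, hxy]
      obtain ⟨h1, h2⟩ := (add_eq_add_iff_eq_and_eq hx hy).1 hsum
      exact hne (Prod.ext (hφ h1) (hφ h2))
    · intro h
      rw [Finset.HasAntidiagonal.mem_antidiagonal] at h
      exact absurd rfl h

protected theorem pow (hφ : Function.Injective φ) (hp : HasExtremalCoeff φ d k p) (n : ℕ) :
    HasExtremalCoeff φ (n • d) (k ^ n) (p ^ n) := by
  induction n with
  | zero => simpa using HasExtremalCoeff.one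
  | succ n ih => simpa only [pow_succ, succ_nsmul] using ih.mul hφ hp

theorem of_X_mul {i : σ}
    (h : HasExtremalCoeff φ (d + Finsupp.single i 1) k (MvPolynomial.X i * p)) :
    HasExtremalCoeff φ d k p := by
  constructor
  · intro e he
    have := h.1 (e + Finsupp.single i 1) (by rwa [add_comm, coeff_X_mul])
    rw [map_add, map_add] at this
    exact le_of_add_le_add_right this
  · rw [← h.2, add_comm, coeff_X_mul]

end HasExtremalCoeff

/-- The Euler operator `X i * ∂/∂X i` scales each coefficient by the exponent of `X i`. -/
theorem coeff_X_mul_pderiv (i : σ) (p : MvPolynomial σ R) (e : σ →₀ ℕ) :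
    coeff e (X i * pderiv i p) = (e i : R) * coeff e p := by
  classical
  induction p using MvPolynomial.induction_on' with
  | add p q hp hq => rw [map_add, mul_add, coeff_add, coeff_add, hp, hq, mul_add]
  | monomial s r =>
    rw [X_mul_pderiv_monomial, coeff_smul, coeff_monomial]
    split_ifs with h
    · rw [h, nsmul_eq_mul]
    · simp

theorem HasExtremalCoeff.X_mul_pderiv {φ : (σ →₀ ℕ) →+ G} {d : σ →₀ ℕ} {k : R}
    {p : MvPolynomial σ R} (i : σ) (hp : HasExtremalCoeff φ d k p) :
    HasExtremalCoeff φ d ((d i : R) * k) (MvPolynomial.X i * pderiv i p) := by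
  refine ⟨fun e he => hp.1 e fun h => he ?_, ?_⟩
  · rw [coeff_X_mul_pderiv, h, mul_zero]
  · rw [coeff_X_mul_pderiv, hp.2]

end ExtremalMonomial

/-- Extremal coefficients of atomic inflection polynomials, normalized by `P 0 = 1`. -/
theorem HasExtremalCoeff.inflection {σ F G : Type*} [Field F] [CharZero F] [AddCommGroup G]
    [PartialOrder G] [IsOrderedAddMonoid G] {φ : (σ →₀ ℕ) →+ G} (hφ : Function.Injective φ)
    {i : σ} {d : σ →₀ ℕ} {k u : F} {f : MvPolynomial σ F}
    (hf : HasExtremalCoeff φ (d + Finsupp.single i 1) k f) {P : ℕ → MvPolynomial σ F}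
    (hP0 : P 0 = 1)
    (hP : ∀ m : ℕ, C ((m : F) + 1) * P (m + 1) =
      pderiv i (P m) * f + C (u - (m : F)) * (P m * pderiv i f)) (m : ℕ) :
    HasExtremalCoeff φ (m • d)
      (k ^ m / (m.factorial : F) * fallingFactorial (((d i : F) + 1) * u) m) (P m) := by
  induction m with
  | zero => simpa [hP0, fallingFactorial] using HasExtremalCoeff.one
  | succ m ih =>
    have hm : (m : F) + 1 ≠ 0 := Nat.cast_add_one_ne_zero m
    have hPm : MvPolynomial.X i * P (m + 1) = C ((m : F) + 1)⁻¹ *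
        ((MvPolynomial.X i * pderiv i (P m)) * f +
          C (u - (m : F)) * (P m * (MvPolynomial.X i * pderiv i f))) := by
      have h : C ((m : F) + 1)⁻¹ * C ((m : F) + 1) = (1 : MvPolynomial σ F) := by
        rw [← C_mul, inv_mul_cancel₀ hm, C_1]
      linear_combination (C ((m : F) + 1)⁻¹ * MvPolynomial.X i) * hP m -
        (MvPolynomial.X i * P (m + 1)) * h
    apply of_X_mul (i := i)
    rw [hPm, succ_nsmul, add_assoc]
    convert (((ih.X_mul_pderiv i).mul hφ hf).add
      ((ih.mul hφ (hf.X_mul_pderiv i)).C_mul (u - (m : F)))).C_mul ((m : F) + 1)⁻¹ using 1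
    have hfac : (m.factorial : F) ≠ 0 := Nat.cast_ne_zero.2 m.factorial_ne_zero
    rw [fallingFactorial, Finset.prod_range_succ, ← fallingFactorial, Nat.factorial_succ]
    simp only [Finsupp.add_apply, Finsupp.smul_apply, Finsupp.single_eq_same, smul_eq_mul]
    push_cast
    field_simp
    ring

/-- The functional `(i, j) ↦ (s * (i + j), t * j)` on exponents in two variables. -/
def legendreWeight (s t : ℤ) : (Fin 2 →₀ ℕ) →+ ℤ × ℤ where
  toFun e := (s * (e 0 + e 1), t * e 1)
  map_zero' := by simp
  map_add' x y := by ext <;> simp <;> ring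

theorem legendreWeight_apply (s t : ℤ) (e : Fin 2 →₀ ℕ) :
    legendreWeight s t e = (s * (e 0 + e 1), t * e 1) := rfl

theorem legendreWeight_injective {s t : ℤ} (hs : s ≠ 0) (ht : t ≠ 0) :
    Function.Injective (legendreWeight s t) := by
  intro x y h
  simp only [legendreWeight_apply, Prod.mk.injEq, mul_right_inj' hs, mul_right_inj' ht] at h
  ext i
  fin_cases i <;> simp <;> omega

section Factors

variable {R : Type*} [CommRing R] {s t : ℤ}

theorem hasExtremalCoeff_X_sub_one_of_pos (hs : 0 < s) :
    HasExtremalCoeff (legendreWeight s t) (Finsupp.single 0 1) (1 : R) (X 0 - 1) := by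
  simpa [sub_eq_add_neg] using (HasExtremalCoeff.X (R := R) (0 : Fin 2)).add
    (HasExtremalCoeff.one.neg.zero_of_lt
      (by simpa [legendreWeight_apply, Prod.lt_iff] using hs))

theorem hasExtremalCoeff_X_sub_one_of_neg (hs : s < 0) :
    HasExtremalCoeff (legendreWeight s t) 0 (-1 : R) (X 0 - 1) := by
  simpa [sub_eq_add_neg] using ((HasExtremalCoeff.X (R := R) (0 : Fin 2)).zero_of_lt
    (by simpa [legendreWeight_apply, Prod.lt_iff] using hs)).add HasExtremalCoeff.one.neg

theorem hasExtremalCoeff_X_sub_X_of_neg (ht : t < 0) :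
    HasExtremalCoeff (legendreWeight s t) (Finsupp.single 0 1) (1 : R) (X 0 - X 1) := by
  simpa [sub_eq_add_neg] using (HasExtremalCoeff.X (R := R) (0 : Fin 2)).add
    ((HasExtremalCoeff.X 1).neg.zero_of_lt
      (by simpa [legendreWeight_apply, Prod.lt_iff] using ht))

theorem hasExtremalCoeff_X_sub_X_of_pos (ht : 0 < t) :
    HasExtremalCoeff (legendreWeight s t) (Finsupp.single 1 1) (-1 : R) (X 0 - X 1) := by
  simpa [sub_eq_add_neg] using ((HasExtremalCoeff.X (R := R) (0 : Fin 2)).zero_of_lt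
    (by simpa [legendreWeight_apply, Prod.lt_iff] using ht)).add (HasExtremalCoeff.X 1).neg

end Factors

/-- The coefficients of the atomic inflection polynomial `P_m` of
the Legendre pencil `y^n = x^a (x-1)^b (x-λ)^c` at the four vertices of its generic
Newton polygon are the stated normalized falling factorials. -/
theorem legendre_inflection_vertex_coefficients
    (F : Type*) [Field F] [CharZero F]
    (u : F) (a b c : ℕ) (ha : 1 ≤ a) (hb : 1 ≤ b) (hc : 1 ≤ c)
    (f : MvPolynomial (Fin 2) F)
    (hf : f = (X 0) ^ a * (X 0 - 1) ^ b * (X 0 - X 1) ^ c)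
    (P : ℕ → MvPolynomial (Fin 2) F)
    (hP1 : P 1 = C u * pderiv 0 f)
    (hPrec : ∀ m : ℕ, 1 ≤ m →
      C ((m : F) + 1) * P (m + 1) =
        pderiv 0 (P m) * f + C (u - (m : F)) * (P m * pderiv 0 f)) :
    ∀ m : ℕ, 1 ≤ m →
      coeff (Finsupp.single (0 : Fin 2) (m * (a + c) - m)) (P m) =
        (-1 : F) ^ (b * m) / (m.factorial : F) *
          fallingFactorial (((a : F) + (c : F)) * u) m ∧
      coeff (Finsupp.single (0 : Fin 2) (m * (a + b + c) - m)) (P m) =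
        1 / (m.factorial : F) *
          fallingFactorial (((a : F) + (b : F) + (c : F)) * u) m ∧
      coeff (Finsupp.single (0 : Fin 2) (m * a - m) + Finsupp.single 1 (m * c)) (P m) =
        (-1 : F) ^ ((b + c) * m) / (m.factorial : F) *
          fallingFactorial ((a : F) * u) m ∧
      coeff (Finsupp.single (0 : Fin 2) (m * (a + b) - m) + Finsupp.single 1 (m * c)) (P m) =
        (-1 : F) ^ (c * m) / (m.factorial : F) *
          fallingFactorial (((a : F) + (b : F)) * u) m := by
  have key (s t : ℤ) (hs : s ≠ 0) (ht : t ≠ 0) (n l : ℕ) (hn : 1 ≤ n) (d₁ d₂ : Fin 2 →₀ ℕ)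
      (k₁ k₂ : F) (h₁ : HasExtremalCoeff (legendreWeight s t) d₁ k₁ (X 0 - 1))
      (h₂ : HasExtremalCoeff (legendreWeight s t) d₂ k₂ (X 0 - X 1))
      (hd : a • Finsupp.single 0 1 + b • d₁ + c • d₂ = Finsupp.single 0 n + Finsupp.single 1 l)
      (m : ℕ) (hm : 1 ≤ m) :
      coeff (Finsupp.single (0 : Fin 2) (m * n - m) + Finsupp.single 1 (m * l)) (P m) =
        (k₁ ^ b * k₂ ^ c) ^ m / (m.factorial : F) * fallingFactorial ((n : F) * u) m := by
    have hφ := legendreWeight_injective hs ht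
    obtain ⟨n, rfl⟩ := Nat.exists_eq_add_of_le' hn
    have hlead := (((HasExtremalCoeff.X (R := F) (0 : Fin 2)).pow hφ a).mul hφ
      (h₁.pow hφ b)).mul hφ (h₂.pow hφ c)
    rw [← hf, hd, one_pow, one_mul, Finsupp.single_add, add_right_comm] at hlead
    have := (hlead.inflection hφ (P := Function.update P 0 1) (u := u) (by simp) (fun j => by
      rcases j with _ | j
      · simp [hP1]
      · simpa using hPrec (j + 1) (by omega)) m).2
    rw [Function.update_of_ne (by omega)] at this
    simpa [Nat.mul_add] using this
  intro m hm
  refine ⟨?_, ?_, ?_, ?_⟩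
  · have := key (-1) (-1) (by decide) (by decide) (a + c) 0 (by omega) _ _ _ _
      (hasExtremalCoeff_X_sub_one_of_neg (by decide))
      (hasExtremalCoeff_X_sub_X_of_neg (by decide)) (by simp [Finsupp.single_add]) m hm
    simpa [pow_mul] using this
  · have := key 1 (-1) (by decide) (by decide) (a + b + c) 0 (by omega) _ _ _ _
      (hasExtremalCoeff_X_sub_one_of_pos (by decide))
      (hasExtremalCoeff_X_sub_X_of_neg (by decide)) (by simp [Finsupp.single_add]) m hm
    simpa using this
  · have := key (-1) 1 (by decide) (by decide) a c ha _ _ _ _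
      (hasExtremalCoeff_X_sub_one_of_neg (by decide))
      (hasExtremalCoeff_X_sub_X_of_pos (by decide)) (by simp) m hm
    simpa [pow_mul, pow_add] using this
  · have := key 1 1 (by decide) (by decide) (a + b) c (by omega) _ _ _ _
      (hasExtremalCoeff_X_sub_one_of_pos (by decide))
      (hasExtremalCoeff_X_sub_X_of_pos (by decide)) (by simp [Finsupp.single_add]) m hm
    simpa [pow_mul] using this
end

section
/- Let a, b, c, ℓ, n be positive integers with n > (a+b+c)·ℓ, set u = ℓ/n ∈ ℚ, let f = x^a·(x−1)^b·(x−λ)^c ∈ ℚ[x, λ], and let P_m ∈ ℚ[x, λ] (m ≥ 1) be the atomic inflection polynomials attached to (f, u). Then for every m ≥ 1, the convex hull in ℝ² of the support of P_m equals the convex hull of the four points (m(a+c)−m, 0), (m(a+b+c)−m, 0), (ma−m, mc) and (m(a+b)−m, mc). -/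
open MvPolynomial

namespace MvPolynomial

variable {ι R G : Type*} [CommRing R] [AddCommGroup G] [PartialOrder G]

/-- Every exponent in the support of `p` has `Φ`-weight at most that of `d`. -/
def SupportLE (Φ : (ι →₀ ℕ) →+ G) (p : MvPolynomial ι R) (d : ι →₀ ℕ) : Prop :=
  ∀ e, coeff e p ≠ 0 → Φ e ≤ Φ d

/-- The exponent `d` lies in the support of `p` and has the greatest `Φ`-weight there. -/
def IsCorner (Φ : (ι →₀ ℕ) →+ G) (p : MvPolynomial ι R) (d : ι →₀ ℕ) : Prop :=
  SupportLE Φ p d ∧ coeff d p ≠ 0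

variable {Φ : (ι →₀ ℕ) →+ G} {p q : MvPolynomial ι R} {d e : ι →₀ ℕ}

theorem SupportLE.add (hp : SupportLE Φ p d) (hq : SupportLE Φ q d) :
    SupportLE Φ (p + q) d := by
  intro k hk
  by_cases h : coeff k p = 0
  · exact hq k fun h' => hk (by simp [h, h'])
  · exact hp k h

theorem SupportLE.C_mul (r : R) (hp : SupportLE Φ p d) : SupportLE Φ (C r * p) d := by
  intro k hk
  rw [coeff_C_mul] at hk
  exact hp k (right_ne_zero_of_mul hk)

theorem coeff_X_mul_pderiv (i : ι) (p : MvPolynomial ι R) (d : ι →₀ ℕ) :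
    coeff d (X i * pderiv i p) = d i * coeff d p := by
  classical
  induction p using MvPolynomial.induction_on' with
  | monomial e r =>
    rw [X_mul_pderiv_monomial, coeff_smul, coeff_monomial]
    split_ifs with h
    · simp [h]
    · simp
  | add p q hp hq => simp only [map_add, mul_add, coeff_add, hp, hq]

theorem SupportLE.X_mul_pderiv (i : ι) (hp : SupportLE Φ p d) :
    SupportLE Φ (X i * pderiv i p) d := by
  intro k hk
  rw [coeff_X_mul_pderiv] at hk
  exact hp k (right_ne_zero_of_mul hk)

theorem isCorner_monomial {r : R} (hr : r ≠ 0) : IsCorner Φ (monomial d r) d := by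
  classical
  refine ⟨fun k hk => ?_, by simpa using hr⟩
  rw [coeff_monomial] at hk
  rw [(ite_ne_right_iff.1 hk).1]

theorem isCorner_monomial_add_monomial {r s : R} (hr : r ≠ 0) (hne : e ≠ d) (h : Φ e ≤ Φ d) :
    IsCorner Φ (monomial d r + monomial e s) d := by
  classical
  refine ⟨(isCorner_monomial hr).1.add fun k hk => ?_, by simpa [coeff_monomial, hne] using hr⟩
  rw [coeff_monomial] at hk
  rwa [← (ite_ne_right_iff.1 hk).1]

variable [IsOrderedAddMonoid G]

theorem SupportLE.mul (hp : SupportLE Φ p d) (hq : SupportLE Φ q e) :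
    SupportLE Φ (p * q) (d + e) := by
  classical
  intro k hk
  rw [coeff_mul] at hk
  obtain ⟨⟨i, j⟩, hij, h⟩ := Finset.exists_ne_zero_of_sum_ne_zero hk
  rw [Finset.HasAntidiagonal.mem_antidiagonal] at hij
  rw [← hij, map_add, map_add]
  exact add_le_add (hp i (left_ne_zero_of_mul h)) (hq j (right_ne_zero_of_mul h))

theorem SupportLE.coeff_mul (hΦ : Function.Injective Φ) (hp : SupportLE Φ p d)
    (hq : SupportLE Φ q e) : coeff (d + e) (p * q) = coeff d p * coeff e q := by
  classical
  rw [MvPolynomial.coeff_mul]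
  refine Finset.sum_eq_single (d, e) ?_ (by simp)
  rintro ⟨i, j⟩ hij hne
  rw [Finset.HasAntidiagonal.mem_antidiagonal] at hij
  by_contra h
  have hi := hp i (left_ne_zero_of_mul h)
  have hj := hq j (right_ne_zero_of_mul h)
  have hsum : Φ i + Φ j = Φ d + Φ e := by rw [← map_add, ← map_add, ← hij]
  obtain ⟨h₁, h₂⟩ := (add_eq_add_iff_eq_and_eq hi hj).1 hsum
  exact hne (Prod.ext (hΦ h₁) (hΦ h₂))

theorem IsCorner.of_X_mul {i : ι} (h : IsCorner Φ (X i * p) (d + Finsupp.single i 1)) :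
    IsCorner Φ p d := by
  have hcoeff (k : ι →₀ ℕ) : coeff (k + Finsupp.single i 1) (X i * p) = coeff k p := by
    rw [add_comm, coeff_X_mul]
  refine ⟨fun k hk => ?_, hcoeff d ▸ h.2⟩
  have := h.1 (k + Finsupp.single i 1) (by rwa [hcoeff])
  rwa [map_add, map_add, add_le_add_iff_right] at this

theorem IsCorner.mul [NoZeroDivisors R] (hΦ : Function.Injective Φ) (hp : IsCorner Φ p d)
    (hq : IsCorner Φ q e) : IsCorner Φ (p * q) (d + e) :=
  ⟨hp.1.mul hq.1, hp.1.coeff_mul hΦ hq.1 ▸ mul_ne_zero hp.2 hq.2⟩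

theorem IsCorner.pow [NoZeroDivisors R] [Nontrivial R] (hΦ : Function.Injective Φ)
    (hp : IsCorner Φ p d) (k : ℕ) : IsCorner Φ (p ^ k) (k • d) := by
  induction k with
  | zero => simpa using isCorner_monomial (Φ := Φ) (d := 0) (one_ne_zero (α := R))
  | succ k ih => rw [pow_succ, succ_nsmul]; exact ih.mul hΦ hp

/-- A corner `d + single i 1` of `f` makes `m • d` a corner of the `m`-th atomic inflection
polynomial, provided the corner exponent times `u` is not a natural number. -/
theorem IsCorner.inflection {K : Type*} [Field K] [CharZero K] {i : ι} {u : K}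
    {f : MvPolynomial ι K} {P : ℕ → MvPolynomial ι K}
    (hP1 : P 1 = C u * pderiv i f)
    (hPrec : ∀ m : ℕ, 1 ≤ m → C ((m : K) + 1) * P (m + 1) =
      pderiv i (P m) * f + C (u - (m : K)) * (P m * pderiv i f))
    (hΦ : Function.Injective Φ) (hf : IsCorner Φ f (d + Finsupp.single i 1))
    (hu : ∀ m : ℕ, u * ((d i : K) + 1) ≠ m) {m : ℕ} (hm : 1 ≤ m) :
    IsCorner Φ (P m) (m • d) := by
  induction m, hm using Nat.le_induction with
  | base =>
    rw [one_smul]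
    refine IsCorner.of_X_mul (i := i) ?_
    have hX : X i * P 1 = C u * (X i * pderiv i f) := by rw [hP1]; ring
    rw [hX]
    refine ⟨(hf.1.X_mul_pderiv i).C_mul u, ?_⟩
    rw [coeff_C_mul, coeff_X_mul_pderiv, ← mul_assoc]
    exact mul_ne_zero (by simpa using hu 0) hf.2
  | succ m hm ih =>
    have hm0 : (m : K) + 1 ≠ 0 := by exact_mod_cast m.succ_ne_zero
    have hX : X i * P (m + 1) = C ((m : K) + 1)⁻¹ *
        (X i * pderiv i (P m) * f + C (u - (m : K)) * (P m * (X i * pderiv i f))) := by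
      have hinv : C ((m : K) + 1)⁻¹ * C ((m : K) + 1) = (1 : MvPolynomial ι K) := by
        rw [← C_mul, inv_mul_cancel₀ hm0, C_1]
      linear_combination C ((m : K) + 1)⁻¹ * X i * hPrec m hm - X i * P (m + 1) * hinv
    refine IsCorner.of_X_mul (i := i) ?_
    rw [hX, succ_nsmul, add_assoc]
    have h₁ := ih.1.X_mul_pderiv i
    have h₂ := hf.1.X_mul_pderiv i
    refine ⟨((h₁.mul hf.1).add ((ih.1.mul h₂).C_mul _)).C_mul _, ?_⟩
    rw [coeff_C_mul, coeff_add, coeff_C_mul, h₁.coeff_mul hΦ hf.1, ih.1.coeff_mul hΦ h₂,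
      coeff_X_mul_pderiv, coeff_X_mul_pderiv]
    refine mul_ne_zero (inv_ne_zero hm0) ?_
    have hfac : u * ((d i : K) + 1) - m ≠ 0 := sub_ne_zero.2 (hu m)
    convert mul_ne_zero hfac (mul_ne_zero ih.2 hf.2) using 1
    simp only [Finsupp.smul_apply, Finsupp.add_apply, Finsupp.single_eq_same, smul_eq_mul]
    push_cast
    ring

end MvPolynomial

/-- The pair of functionals `σ (d₀ + d₁)` and `τ d₁` on exponents of bivariate monomials. -/
def trapezoidWeight (σ τ : ℤ) : (Fin 2 →₀ ℕ) →+ ℤ × ℤ where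
  toFun d := (σ * (d 0 + d 1), τ * d 1)
  map_zero' := by simp
  map_add' d e := by
    ext <;> simp only [Finsupp.add_apply, Prod.mk_add_mk] <;> push_cast <;> ring

theorem trapezoidWeight_apply (σ τ : ℤ) (d : Fin 2 →₀ ℕ) :
    trapezoidWeight σ τ d = (σ * (d 0 + d 1), τ * d 1) := rfl

theorem trapezoidWeight_injective {σ τ : ℤ} (hσ : σ ≠ 0) (hτ : τ ≠ 0) :
    Function.Injective (trapezoidWeight σ τ) := by
  intro d e h
  simp only [trapezoidWeight_apply, Prod.mk.injEq, mul_right_inj' hσ, mul_right_inj' hτ] at h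
  ext i
  fin_cases i
  · change d 0 = e 0
    omega
  · change d 1 = e 1
    omega

/-- For each choice of signs, the corner of `x^a (x-1)^b (x-λ)^c` is the product of the corners
`δ` of `x - 1` and `ε` of `x - λ`, and of `x`. -/
theorem isCorner_legendre {σ τ : ℤ} (hσ : σ ≠ 0) (hτ : τ ≠ 0) (a b c : ℕ) {δ ε : Fin 2 →₀ ℕ}
    (hδ : MvPolynomial.IsCorner (trapezoidWeight σ τ) (X 0 - 1 : MvPolynomial (Fin 2) ℚ) δ)
    (hε : MvPolynomial.IsCorner (trapezoidWeight σ τ) (X 0 - X 1 : MvPolynomial (Fin 2) ℚ) ε) :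
    MvPolynomial.IsCorner (trapezoidWeight σ τ)
      ((X 0) ^ a * (X 0 - 1) ^ b * (X 0 - X 1) ^ c : MvPolynomial (Fin 2) ℚ)
      (a • Finsupp.single 0 1 + b • δ + c • ε) := by
  have hinj := trapezoidWeight_injective hσ hτ
  have hX : MvPolynomial.IsCorner (trapezoidWeight σ τ) (X 0 : MvPolynomial (Fin 2) ℚ)
      (Finsupp.single 0 1) := isCorner_monomial one_ne_zero
  exact ((hX.pow hinj a).mul hinj (hδ.pow hinj b)).mul hinj (hε.pow hinj c)

section LinearFactors

variable {R : Type*} [CommRing R] [Nontrivial R] {σ τ : ℤ}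

theorem isCorner_X_sub_one_left (hσ : 0 ≤ σ) :
    MvPolynomial.IsCorner (trapezoidWeight σ τ) (X 0 - 1 : MvPolynomial (Fin 2) R)
      (Finsupp.single 0 1) := by
  have h : (X 0 - 1 : MvPolynomial (Fin 2) R) =
      monomial (Finsupp.single 0 1) 1 + monomial 0 (-1) := by
    rw [map_neg, ← sub_eq_add_neg]; rfl
  rw [h]
  refine isCorner_monomial_add_monomial one_ne_zero (by simp [eq_comm]) ?_
  simp [trapezoidWeight_apply, Prod.le_def, hσ]

theorem isCorner_X_sub_one_right (hσ : σ ≤ 0) :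
    MvPolynomial.IsCorner (trapezoidWeight σ τ) (X 0 - 1 : MvPolynomial (Fin 2) R) 0 := by
  have h : (X 0 - 1 : MvPolynomial (Fin 2) R) =
      monomial 0 (-1) + monomial (Finsupp.single 0 1) 1 := by
    rw [add_comm, map_neg, ← sub_eq_add_neg]; rfl
  rw [h]
  refine isCorner_monomial_add_monomial (neg_ne_zero.2 one_ne_zero) (by simp) ?_
  simp [trapezoidWeight_apply, Prod.le_def, hσ]

theorem isCorner_X_sub_X_left (hτ : τ ≤ 0) :
    MvPolynomial.IsCorner (trapezoidWeight σ τ) (X 0 - X 1 : MvPolynomial (Fin 2) R)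
      (Finsupp.single 0 1) := by
  have h : (X 0 - X 1 : MvPolynomial (Fin 2) R) =
      monomial (Finsupp.single 0 1) 1 + monomial (Finsupp.single 1 1) (-1) := by
    rw [map_neg, ← sub_eq_add_neg]; rfl
  rw [h]
  refine isCorner_monomial_add_monomial one_ne_zero
    (by simp [Finsupp.single_left_inj]) ?_
  simp [trapezoidWeight_apply, Prod.le_def, hτ]

theorem isCorner_X_sub_X_right (hτ : 0 ≤ τ) :
    MvPolynomial.IsCorner (trapezoidWeight σ τ) (X 0 - X 1 : MvPolynomial (Fin 2) R)
      (Finsupp.single 1 1) := by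
  have h : (X 0 - X 1 : MvPolynomial (Fin 2) R) =
      monomial (Finsupp.single 1 1) (-1) + monomial (Finsupp.single 0 1) 1 := by
    rw [add_comm, map_neg, ← sub_eq_add_neg]; rfl
  rw [h]
  refine isCorner_monomial_add_monomial (neg_ne_zero.2 one_ne_zero)
    (by simp [Finsupp.single_left_inj]) ?_
  simp [trapezoidWeight_apply, Prod.le_def, hτ]

end LinearFactors

theorem mem_convexHull_trapezoid {s t q x y : ℝ} (hst : s < t) (hq : 0 < q)
    (hs : s ≤ x + y) (ht : x + y ≤ t) (hy : 0 ≤ y) (hyq : y ≤ q) :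
    (x, y) ∈ convexHull ℝ ({(s, 0), (t, 0), (s - q, q), (t - q, q)} : Set (ℝ × ℝ)) := by
  set H := convexHull ℝ ({(s, 0), (t, 0), (s - q, q), (t - q, q)} : Set (ℝ × ℝ))
  have hH : Convex ℝ H := convex_convexHull ℝ _
  have hweight {z w : ℝ} (hz : 0 ≤ z) (hzw : z ≤ w) (hw : 0 < w) :
      0 ≤ 1 - z / w ∧ 0 ≤ z / w :=
    ⟨sub_nonneg.2 ((div_le_one hw).2 hzw), div_nonneg hz hw.le⟩
  obtain ⟨hα, hβ⟩ := hweight hy hyq hq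
  have edge {r : ℝ} (h₀ : (r, 0) ∈ H) (h₁ : (r - q, q) ∈ H) : (r - y, y) ∈ H := by
    convert hH h₀ h₁ hα hβ (by ring) using 1
    ext
    · simp
      field_simp
      ring
    · simp
      field_simp
  have hleft : (s - y, y) ∈ H :=
    edge (subset_convexHull ℝ _ (by simp)) (subset_convexHull ℝ _ (by simp))
  have hright : (t - y, y) ∈ H :=
    edge (subset_convexHull ℝ _ (by simp)) (subset_convexHull ℝ _ (by simp))
  have hts : 0 < t - s := sub_pos.2 hst
  obtain ⟨hα', hβ'⟩ := hweight (sub_nonneg.2 hs) (sub_le_sub_right ht s) hts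
  convert hH hleft hright hα' hβ' (by ring) using 1
  ext
  · simp
    field_simp
    ring
  · simp
    ring

/-- Whenever `n > (a+b+c)ℓ` and `u = ℓ/n`, the Newton polygon of the
atomic inflection polynomial `P_m` of the Legendre pencil `y^n = x^a (x-1)^b (x-λ)^c`
over `ℚ` is the quadrilateral with vertices `(m(a+c)-m, 0)`, `(m(a+b+c)-m, 0)`,
`(ma-m, mc)`, `(m(a+b)-m, mc)`. -/
theorem legendre_inflection_generic_newton_polygon
    (a b c ℓ n : ℕ) (ha : 1 ≤ a) (hb : 1 ≤ b) (hc : 1 ≤ c) (hℓ : 1 ≤ ℓ)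
    (hn : (a + b + c) * ℓ < n)
    (u : ℚ) (hu : u = (ℓ : ℚ) / (n : ℚ))
    (f : MvPolynomial (Fin 2) ℚ)
    (hf : f = (X 0) ^ a * (X 0 - 1) ^ b * (X 0 - X 1) ^ c)
    (P : ℕ → MvPolynomial (Fin 2) ℚ)
    (hP1 : P 1 = C u * pderiv 0 f)
    (hPrec : ∀ m : ℕ, 1 ≤ m →
      C ((m : ℚ) + 1) * P (m + 1) =
        pderiv 0 (P m) * f + C (u - (m : ℚ)) * (P m * pderiv 0 f)) :
    ∀ m : ℕ, 1 ≤ m →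
      convexHull ℝ
        ((fun d : Fin 2 →₀ ℕ => (((d 0 : ℕ) : ℝ), ((d 1 : ℕ) : ℝ))) ''
          ((P m).support : Set (Fin 2 →₀ ℕ))) =
      convexHull ℝ
        ({(((m * (a + c) - m : ℕ) : ℝ), (0 : ℝ)),
          (((m * (a + b + c) - m : ℕ) : ℝ), (0 : ℝ)),
          (((m * a - m : ℕ) : ℝ), ((m * c : ℕ) : ℝ)),
          (((m * (a + b) - m : ℕ) : ℝ), ((m * c : ℕ) : ℝ))} : Set (ℝ × ℝ)) := by
  subst hf
  intro m hm
  obtain ⟨a, rfl⟩ := Nat.exists_eq_add_of_le' ha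
  have hur (r : ℕ) (hr : r + 1 ≤ a + 1 + b + c) (k : ℕ) : u * ((r : ℚ) + 1) ≠ k := by
    have hn0 : (0 : ℚ) < n := by exact_mod_cast (Nat.zero_le _).trans_lt hn
    rw [hu, div_mul_eq_mul_div, Ne, div_eq_iff hn0.ne']
    norm_cast
    have hlt : ℓ * (r + 1) < n :=
      lt_of_le_of_lt (by rw [mul_comm]; exact Nat.mul_le_mul_right ℓ hr) hn
    rcases Nat.eq_zero_or_pos k with rfl | hk
    · rw [zero_mul]; positivity
    · exact (hlt.trans_le (Nat.le_mul_of_pos_left n hk)).ne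
  have corner {σ τ : ℤ} (hσ : σ ≠ 0) (hτ : τ ≠ 0) {δ ε : Fin 2 →₀ ℕ} (hδ1 : δ 0 ≤ 1)
      (hε1 : ε 0 ≤ 1)
      (hδ : MvPolynomial.IsCorner (trapezoidWeight σ τ) (X 0 - 1 : MvPolynomial (Fin 2) ℚ) δ)
      (hε : MvPolynomial.IsCorner (trapezoidWeight σ τ) (X 0 - X 1 : MvPolynomial (Fin 2) ℚ) ε) :
      MvPolynomial.IsCorner (trapezoidWeight σ τ) (P m)
        (m • (a • Finsupp.single 0 1 + b • δ + c • ε)) := by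
    refine IsCorner.inflection hP1 hPrec (trapezoidWeight_injective hσ hτ) ?_
      (hur _ ?_) hm
    · have hshift : a • Finsupp.single 0 1 + b • δ + c • ε + Finsupp.single 0 1 =
          (a + 1) • Finsupp.single 0 1 + b • δ + c • ε := by
        rw [succ_nsmul]; abel
      exact hshift ▸ isCorner_legendre hσ hτ (a + 1) b c hδ hε
    · simp only [Finsupp.add_apply, Finsupp.smul_apply, Finsupp.single_eq_same, smul_eq_mul]
      nlinarith
  have h₁ := corner (σ := -1) (τ := -1) (by simp) (by simp) (by simp) (by simp)
    (isCorner_X_sub_one_right (by simp)) (isCorner_X_sub_X_left (by simp))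
  have h₂ := corner (σ := 1) (τ := -1) (by simp) (by simp) (by simp) (by simp)
    (isCorner_X_sub_one_left (by simp)) (isCorner_X_sub_X_left (by simp))
  have h₃ := corner (σ := -1) (τ := 1) (by simp) (by simp) (by simp) (by simp)
    (isCorner_X_sub_one_right (by simp)) (isCorner_X_sub_X_right (by simp))
  have h₄ := corner (σ := 1) (τ := 1) (by simp) (by simp) (by simp) (by simp)
    (isCorner_X_sub_one_left (by simp)) (isCorner_X_sub_X_right (by simp))
  have e₁ : m * (a + 1 + c) - m = m * (a + c) := by
    rw [Nat.sub_eq_iff_eq_add (Nat.le_mul_of_pos_right m (by omega))]; ring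
  have e₂ : m * (a + 1 + b + c) - m = m * (a + b + c) := by
    rw [Nat.sub_eq_iff_eq_add (Nat.le_mul_of_pos_right m (by omega))]; ring
  have e₃ : m * (a + 1) - m = m * a := by
    rw [Nat.sub_eq_iff_eq_add (Nat.le_mul_of_pos_right m (by omega))]; ring
  have e₄ : m * (a + 1 + b) - m = m * (a + b) := by
    rw [Nat.sub_eq_iff_eq_add (Nat.le_mul_of_pos_right m (by omega))]; ring
  rw [e₁, e₂, e₃, e₄]
  refine Set.Subset.antisymm (convexHull_min ?_ (convex_convexHull ℝ _))
    (convexHull_mono ?_)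
  · rintro _ ⟨d, hd, rfl⟩
    have hd' : coeff d (P m) ≠ 0 := by simpa using hd
    have hlow := (h₁.1 d hd').1
    obtain ⟨hs, hy⟩ := h₄.1 d hd'
    simp [trapezoidWeight_apply] at hlow hs hy
    have hmR : (0 : ℝ) < m := by exact_mod_cast hm
    have hbR : (0 : ℝ) < b := by exact_mod_cast hb
    have hcR : (0 : ℝ) < c := by exact_mod_cast hc
    have hlow' : (m * (a + c) : ℝ) ≤ d 0 + d 1 := by
      exact_mod_cast (by linarith : (m * (a + c) : ℤ) ≤ d 0 + d 1)
    have hs' : (d 0 + d 1 : ℝ) ≤ m * (a + b + c) := by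
      exact_mod_cast (by linarith : (d 0 + d 1 : ℤ) ≤ m * (a + b + c))
    have hy' : (d 1 : ℝ) ≤ m * c := by exact_mod_cast hy
    convert mem_convexHull_trapezoid (s := m * (a + c)) (t := m * (a + b + c)) (q := m * c)
      (by nlinarith) (by positivity) hlow' hs' (Nat.cast_nonneg _) hy' using 3 <;> push_cast
    all_goals ring_nf
  · have hmem {v : Fin 2 →₀ ℕ} (hv : coeff v (P m) ≠ 0) :
        (((v 0 : ℕ) : ℝ), ((v 1 : ℕ) : ℝ)) ∈
        ((fun d : Fin 2 →₀ ℕ => (((d 0 : ℕ) : ℝ), ((d 1 : ℕ) : ℝ))) ''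
          ((P m).support : Set (Fin 2 →₀ ℕ))) := ⟨v, by simpa using hv, rfl⟩
    rintro _ (rfl | rfl | rfl | rfl)
    · simpa [mul_add] using hmem h₁.2
    · simpa [mul_add] using hmem h₂.2
    · simpa [mul_add] using hmem h₃.2
    · simpa [mul_add] using hmem h₄.2
end

section
/- Let F be a field of characteristic zero, let f = x·(x−1)·(x−λ) ∈ F[x, λ], and let P_m ∈ F[x, λ] (m ≥ 1) be the atomic inflection polynomials attached to (f, u) with u = 1/2. Then for every m ≥ 2, the convex hull in ℝ² of the support of P_m equals the convex hull of the six points (0, m), (m−2, m), (m−2, 2), (2m−1, 1), (2m−1, 0) and (2m, 0). -/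
open MvPolynomial

namespace LegendreInflection

variable {F : Type*} [Field F]

/-- The coefficient of `x ^ i * λ ^ j`, extended by zero to all integer exponents. -/
noncomputable def extCoeff (i j : ℤ) (p : MvPolynomial (Fin 2) F) : F :=
  if 0 ≤ i ∧ 0 ≤ j then
    coeff (Finsupp.single 0 i.toNat + Finsupp.single 1 j.toNat) p
  else 0

lemma extCoeff_natCast (d : Fin 2 →₀ ℕ) (p : MvPolynomial (Fin 2) F) :
    extCoeff (d 0) (d 1) p = coeff d p := by
  have h : Finsupp.single 0 (d 0) + Finsupp.single 1 (d 1) = d := by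
    ext a
    fin_cases a <;> simp
  simp [extCoeff, h]

lemma extCoeff_add (i j : ℤ) (p q : MvPolynomial (Fin 2) F) :
    extCoeff i j (p + q) = extCoeff i j p + extCoeff i j q := by
  unfold extCoeff
  split_ifs <;> simp

lemma extCoeff_sub (i j : ℤ) (p q : MvPolynomial (Fin 2) F) :
    extCoeff i j (p - q) = extCoeff i j p - extCoeff i j q := by
  unfold extCoeff
  split_ifs <;> simp

lemma extCoeff_C_mul (i j : ℤ) (c : F) (p : MvPolynomial (Fin 2) F) :
    extCoeff i j (C c * p) = c * extCoeff i j p := by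
  unfold extCoeff
  split_ifs <;> simp

lemma extCoeff_monomial (i j : ℤ) (d : Fin 2 →₀ ℕ) (c : F) :
    extCoeff i j (monomial d c) = if (d 0 : ℤ) = i ∧ (d 1 : ℤ) = j then c else 0 := by
  unfold extCoeff
  rw [coeff_monomial]
  have h : (0 ≤ i ∧ 0 ≤ j) →
      (d = Finsupp.single 0 i.toNat + Finsupp.single 1 j.toNat ↔
        (d 0 : ℤ) = i ∧ (d 1 : ℤ) = j) := by
    rintro ⟨hi, hj⟩
    constructor
    · rintro rfl
      simp [hi, hj]
    · rintro ⟨h0, h1⟩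
      ext a
      fin_cases a
      · simp [← h0]
      · simp [← h1]
  split_ifs <;> first | rfl | (exfalso; grind)

lemma extCoeff_one (i j : ℤ) :
    extCoeff i j (1 : MvPolynomial (Fin 2) F) = if i = 0 ∧ j = 0 then 1 else 0 := by
  rw [← C_1, ← monomial_zero', extCoeff_monomial]
  simp [eq_comm]

lemma extCoeff_X_zero_mul (i j : ℤ) (p : MvPolynomial (Fin 2) F) :
    extCoeff i j (X 0 * p) = extCoeff (i - 1) j p := by
  induction p using MvPolynomial.induction_on' with
  | monomial d c =>
    rw [X, monomial_mul, extCoeff_monomial, extCoeff_monomial]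
    simp
    grind
  | add p q hp hq => rw [mul_add, extCoeff_add, extCoeff_add, hp, hq]

lemma extCoeff_X_one_mul (i j : ℤ) (p : MvPolynomial (Fin 2) F) :
    extCoeff i j (X 1 * p) = extCoeff i (j - 1) p := by
  induction p using MvPolynomial.induction_on' with
  | monomial d c =>
    rw [X, monomial_mul, extCoeff_monomial, extCoeff_monomial]
    simp
    grind
  | add p q hp hq => rw [mul_add, extCoeff_add, extCoeff_add, hp, hq]

lemma extCoeff_pderiv_zero (i j : ℤ) (p : MvPolynomial (Fin 2) F) :
    extCoeff i j (pderiv 0 p) = ((i : F) + 1) * extCoeff (i + 1) j p := by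
  induction p using MvPolynomial.induction_on' with
  | monomial d c =>
    rw [pderiv_monomial, extCoeff_monomial, extCoeff_monomial]
    rcases Nat.eq_zero_or_pos (d 0) with h | h
    · by_cases hi : i = -1
      · simp [h, hi]
      · have : ¬ (0 : ℤ) = i + 1 := by omega
        simp [h, this]
    · have h' : (((d - Finsupp.single 0 1 : Fin 2 →₀ ℕ) 0 : ℕ) : ℤ) = (d 0 : ℤ) - 1 := by
        simp; omega
      have h'' : (d - Finsupp.single 0 1 : Fin 2 →₀ ℕ) 1 = d 1 := by simp
      rw [h', h'']
      by_cases hc : (d 0 : ℤ) = i + 1 ∧ (d 1 : ℤ) = j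
      · have hF : (d 0 : F) = (i : F) + 1 := by exact_mod_cast congrArg (Int.cast : ℤ → F) hc.1
        rw [if_pos hc, if_pos ⟨by omega, hc.2⟩, hF, mul_comm]
      · rw [if_neg hc, if_neg (by omega), mul_zero]
  | add p q hp hq => rw [map_add, extCoeff_add, extCoeff_add, hp, hq, mul_add]

lemma extCoeff_inflection_step (i j : ℤ) (v : F) (p f : MvPolynomial (Fin 2) F)
    (hf : f = X 0 * (X 0 - 1) * (X 0 - X 1)) :
    extCoeff i j (pderiv 0 p * f + C v * (p * pderiv 0 f)) =
      (i - 2 + 3 * v) * extCoeff (i - 2) j p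
        - (i - 1 + 2 * v) * (extCoeff (i - 1) j p + extCoeff (i - 1) (j - 1) p)
        + (i + v) * extCoeff i (j - 1) p := by
  have hp : pderiv 0 p * f + C v * (p * pderiv 0 f) =
      X 0 * (X 0 * (X 0 * pderiv 0 p)) - X 0 * (X 0 * pderiv 0 p)
        - X 1 * (X 0 * (X 0 * pderiv 0 p)) + X 1 * (X 0 * pderiv 0 p)
        + C (3 * v) * (X 0 * (X 0 * p)) - C (2 * v) * (X 0 * p)
        - C (2 * v) * (X 1 * (X 0 * p)) + C v * (X 1 * p) := by
    have h1 : pderiv (0 : Fin 2) (X 1 : MvPolynomial (Fin 2) F) = 0 :=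
      pderiv_X_of_ne (by decide)
    have h2 : (C (2 : F) : MvPolynomial (Fin 2) F) = 2 := map_ofNat C 2
    have h3 : (C (3 : F) : MvPolynomial (Fin 2) F) = 3 := map_ofNat C 3
    simp only [hf, Derivation.leibniz, map_sub, pderiv_X_self, h1, pderiv_one, smul_eq_mul,
      C_mul, h2, h3]
    ring
  rw [hp]
  simp only [extCoeff_add, extCoeff_sub, extCoeff_C_mul, extCoeff_X_zero_mul,
    extCoeff_X_one_mul, extCoeff_pderiv_zero]
  have e1 : i - 2 - 1 + 1 = i - 2 := by ring
  have e2 : i - 2 + 1 = i - 1 := by ring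
  have e3 : i - 1 + 1 = i := by ring
  have e4 : i - 1 - 1 = i - 2 := by ring
  simp only [e1, e2, e3, e4]
  push_cast
  ring

/-- The coefficients `b m j k` of `x ^ (2 * m - j - k) * λ ^ j * μ ^ k` in the homogenized
inflection polynomials of `x * (x - μ) * (x - λ)`, described by their recursion. -/
structure IsCoeffTable (b : ℕ → ℤ → ℤ → F) : Prop where
  zero : ∀ j k, b 0 j k = if j = 0 ∧ k = 0 then 1 else 0
  succ : ∀ (m : ℕ) (j k : ℤ), ((m : F) + 1) * b (m + 1) j k =
    (3 / 2 - m - j - k) * b m j k - (2 - j - k) * (b m j (k - 1) + b m (j - 1) k)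
      + (m + 5 / 2 - j - k) * b m (j - 1) (k - 1)

namespace IsCoeffTable

variable {b : ℕ → ℤ → ℤ → F}

lemma swap (hb : IsCoeffTable b) : IsCoeffTable fun m j k => b m k j where
  zero j k := by simp only [hb.zero, and_comm]
  succ m j k := by rw [hb.succ]; ring

variable [CharZero F]

lemma eq_zero_of_neg (hb : IsCoeffTable b) (m : ℕ) {j : ℤ} (k : ℤ) (hj : j < 0) :
    b m j k = 0 := by
  induction m generalizing j k with
  | zero => rw [hb.zero, if_neg (by omega)]
  | succ m ih =>
    refine (mul_eq_zero.mp ?_).resolve_left (Nat.cast_add_one_ne_zero (R := F) m)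
    rw [hb.succ, ih _ hj, ih _ hj, ih _ (by omega), ih _ (by omega)]
    ring

lemma eq_zero_of_lt (hb : IsCoeffTable b) (m : ℕ) {j : ℤ} (k : ℤ) (hj : (m : ℤ) < j) :
    b m j k = 0 := by
  induction m generalizing j k with
  | zero => rw [hb.zero, if_neg (by omega)]
  | succ m ih =>
    push_cast at hj
    refine (mul_eq_zero.mp ?_).resolve_left (Nat.cast_add_one_ne_zero (R := F) m)
    rw [hb.succ, ih _ (by omega), ih _ (by omega), ih _ (by omega), ih _ (by omega)]
    ring

lemma corner_relations (hb : IsCoeffTable b) (m : ℕ) :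
    3 * b m 1 0 = -2 * m * b m 0 0 ∧ b m 1 1 = -(m - 1 / 2) * b m 1 0 ∧
      3 * b m 0 1 = -2 * m * b m 0 0 := by
  induction m with
  | zero => simp [hb.zero]
  | succ m ih =>
    obtain ⟨h1, h2, h3⟩ := ih
    have hm : (m : F) + 1 ≠ 0 := Nat.cast_add_one_ne_zero m
    have h00 := hb.succ m 0 0
    have h10 := hb.succ m 1 0
    have h01 := hb.succ m 0 1
    have h11 := hb.succ m 1 1
    have z := fun k => hb.eq_zero_of_neg m (j := -1) k (by omega)
    have z' := fun j => hb.swap.eq_zero_of_neg m (j := -1) j (by omega)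
    norm_num [z, z'] at h00 h10 h01 h11
    push_cast
    refine ⟨mul_left_cancel₀ hm ?_, mul_left_cancel₀ hm ?_, mul_left_cancel₀ hm ?_⟩
    · linear_combination 3 * h10 + 2 * (m + 1) * h00 + (1 / 2 - m) * h1
    · linear_combination h11 + (m + 1 / 2) * h10 - (m + 1 / 2) * h2
    · linear_combination 3 * h01 + 2 * (m + 1) * h00 + (1 / 2 - m) * h3

lemma eq_zero_of_two_le (hb : IsCoeffTable b) (m : ℕ) {j : ℤ} (hj : 2 ≤ j) :
    b m j 0 = 0 ∧ b m j 1 = 0 := by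
  induction m generalizing j with
  | zero => rw [hb.zero, hb.zero, if_neg (by omega), if_neg (by omega)]; simp
  | succ m ih =>
    have hm : (m : F) + 1 ≠ 0 := Nat.cast_add_one_ne_zero m
    have h0 := hb.succ m j 0
    have h1 := hb.succ m j 1
    have z' := fun j => hb.swap.eq_zero_of_neg m (j := -1) j (by omega)
    norm_num [z', ih hj] at h0 h1
    obtain rfl | hj' := hj.eq_or_lt
    · norm_num [(hb.corner_relations m).2.1] at h0 h1
      exact ⟨h0.resolve_left hm, (mul_eq_zero.mp (by linear_combination h1)).resolve_left hm⟩
    · norm_num [ih (show 2 ≤ j - 1 by omega)] at h0 h1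
      exact ⟨h0.resolve_left hm, h1.resolve_left hm⟩

lemma intCast_div_two_ne_zero {n : ℤ} (hn : n ≠ 0) : (n : F) / 2 ≠ 0 :=
  div_ne_zero (Int.cast_ne_zero.mpr hn) two_ne_zero

lemma zero_zero_ne_zero (hb : IsCoeffTable b) (m : ℕ) : b m 0 0 ≠ 0 := by
  induction m with
  | zero => simp [hb.zero]
  | succ m ih =>
    intro h
    have h0 := hb.succ m 0 0
    have z := fun k => hb.eq_zero_of_neg m (j := -1) k (by omega)
    have z' := fun j => hb.swap.eq_zero_of_neg m (j := -1) j (by omega)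
    norm_num [z, z', h, ih] at h0
    refine intCast_div_two_ne_zero (F := F) (n := 3 - 2 * m) (by omega) ?_
    push_cast
    linear_combination h0

lemma one_zero_ne_zero (hb : IsCoeffTable b) {m : ℕ} (hm : m ≠ 0) : b m 1 0 ≠ 0 := by
  intro h
  have := (hb.corner_relations m).1
  simp [h, hm, hb.zero_zero_ne_zero m] at this

lemma self_self_ne_zero (hb : IsCoeffTable b) (m : ℕ) : b m m m ≠ 0 := by
  induction m with
  | zero => simp [hb.zero]
  | succ m ih =>
    intro h
    have h0 := hb.succ m (m + 1) (m + 1)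
    have z := fun k => hb.eq_zero_of_lt m (j := m + 1) k (by omega)
    have z' := fun j => hb.swap.eq_zero_of_lt m (j := m + 1) j (by omega)
    push_cast at h
    norm_num [z, z', h, ih] at h0
    refine intCast_div_two_ne_zero (F := F) (n := 1 - 2 * m) (by omega) ?_
    push_cast
    linear_combination h0

lemma self_two_ne_zero (hb : IsCoeffTable b) {m : ℕ} (hm : 2 ≤ m) : b m m 2 ≠ 0 := by
  induction m, hm using Nat.le_induction with
  | base => exact hb.self_self_ne_zero 2
  | succ m hm ih =>
    intro h
    have h0 := hb.succ m (m + 1) 2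
    have z := fun k => hb.eq_zero_of_lt m (j := m + 1) k (by omega)
    push_cast at h
    norm_num [z, h, (hb.eq_zero_of_two_le m (j := m) (by omega)).2] at h0
    exact Nat.cast_add_one_ne_zero (R := F) m (by linear_combination -h0.resolve_right ih)

lemma mem_of_ne_zero (hb : IsCoeffTable b) {m : ℕ} {j k : ℤ} (h : b m j k ≠ 0) :
    0 ≤ j ∧ 0 ≤ k ∧ j ≤ m ∧ k ≤ m ∧ (j ≤ 1 ∧ k ≤ 1 ∨ 2 ≤ j ∧ 2 ≤ k) := by
  have h1 : 0 ≤ j := by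
    by_contra! hj
    exact h (hb.eq_zero_of_neg m k hj)
  have h2 : 0 ≤ k := by
    by_contra! hk
    exact h (hb.swap.eq_zero_of_neg m j hk)
  have h3 : j ≤ m := by
    by_contra! hj
    exact h (hb.eq_zero_of_lt m k hj)
  have h4 : k ≤ m := by
    by_contra! hk
    exact h (hb.swap.eq_zero_of_lt m j hk)
  refine ⟨h1, h2, h3, h4, ?_⟩
  by_contra! hc
  rcases le_or_gt j 1 with hj | hj
  · have hk : 2 ≤ k := hc.1 hj
    have := hb.swap.eq_zero_of_two_le m hk
    obtain rfl | rfl : j = 0 ∨ j = 1 := by omega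
    exacts [h this.1, h this.2]
  · have hk : k < 2 := hc.2 hj
    have := hb.eq_zero_of_two_le m (j := j) hj
    obtain rfl | rfl : k = 0 ∨ k = 1 := by omega
    exacts [h this.1, h this.2]

end IsCoeffTable

/-- A convex set containing the corners `(0, 0)`, `(m, m)`, `(m, 2)` contains the points of the
square `[2, m] × [2, m]` below the diagonal. -/
lemma mem_of_convex_of_le {T : Set (ℝ × ℝ)} (hT : Convex ℝ T) {m j k : ℝ}
    (h0 : (0, 0) ∈ T) (hm : (m, m) ∈ T) (h2 : (m, 2) ∈ T)
    (hk : 2 ≤ k) (hkj : k ≤ j) (hj : j ≤ m) : (j, k) ∈ T := by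
  have diag : (k, k) ∈ T := by
    have hS : Convex ℝ {t : ℝ | (t, t) ∈ T} := by
      intro s hs t ht a c ha hc hac
      simpa using hT hs ht ha hc hac
    exact hS.ordConnected.out h0 hm ⟨by linarith, by linarith⟩
  have vert : (m, k) ∈ T := by
    have hS : Convex ℝ {t : ℝ | (m, t) ∈ T} := by
      intro s hs t ht a c ha hc hac
      simpa [← add_mul, hac] using hT hs ht ha hc hac
    exact hS.ordConnected.out h2 hm ⟨by linarith, by linarith⟩
  have hS : Convex ℝ {t : ℝ | (t, k) ∈ T} := by
    intro s hs t ht a c ha hc hac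
    simpa [← add_mul, hac] using hT hs ht ha hc hac
  exact hS.ordConnected.out diag vert ⟨hkj, hj⟩

lemma mem_of_convex {T : Set (ℝ × ℝ)} (hT : Convex ℝ T) {m : ℕ} (hm : 2 ≤ m)
    (h00 : (0, 0) ∈ T) (h10 : (1, 0) ∈ T) (h01 : (0, 1) ∈ T)
    (hmm : ((m : ℝ), (m : ℝ)) ∈ T) (hm2 : ((m : ℝ), 2) ∈ T) (h2m : (2, (m : ℝ)) ∈ T) {j k : ℤ}
    (h : 0 ≤ j ∧ 0 ≤ k ∧ j ≤ m ∧ k ≤ m ∧ (j ≤ 1 ∧ k ≤ 1 ∨ 2 ≤ j ∧ 2 ≤ k)) :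
    ((j : ℝ), (k : ℝ)) ∈ T := by
  obtain ⟨hj0, hk0, hjm, hkm, ⟨hj, hk⟩ | ⟨hj, hk⟩⟩ := h
  · have hm' : (2 : ℝ) ≤ m := by exact_mod_cast hm
    have h11 : ((1 : ℝ), (1 : ℝ)) ∈ T := by
      have hS : Convex ℝ {t : ℝ | (t, t) ∈ T} := by
        intro s hs t ht a c ha hc hac
        simpa using hT hs ht ha hc hac
      exact hS.ordConnected.out h00 hmm ⟨by linarith, by linarith⟩
    obtain rfl | rfl : j = 0 ∨ j = 1 := by omega
    all_goals
      obtain rfl | rfl : k = 0 ∨ k = 1 := by omega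
      all_goals simpa
  · have hj' : (2 : ℝ) ≤ j := by exact_mod_cast hj
    have hk' : (2 : ℝ) ≤ k := by exact_mod_cast hk
    have hjm' : (j : ℝ) ≤ m := by exact_mod_cast hjm
    have hkm' : (k : ℝ) ≤ m := by exact_mod_cast hkm
    rcases le_total (k : ℝ) j with hkj | hkj
    · exact mem_of_convex_of_le hT h00 hmm hm2 hk' hkj hjm'
    · have hT' : Convex ℝ {p : ℝ × ℝ | (p.2, p.1) ∈ T} := by
        intro p hp q hq a c ha hc hac
        exact hT hp hq ha hc hac
      exact mem_of_convex_of_le hT' h00 hmm h2m hj' hkj hkm'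

end LegendreInflection

/-- For `u = 1/2`, the Newton polygon of the atomic inflection
polynomial `P_m` (`m ≥ 2`) of the Legendre pencil `y^n = x(x-1)(x-λ)` is the hexagon
with vertices `(0,m)`, `(m-2,m)`, `(m-2,2)`, `(2m-1,1)`, `(2m-1,0)`, `(2m,0)`. -/
theorem legendre_inflection_newton_polygon_u_half
    (F : Type*) [Field F] [CharZero F]
    (f : MvPolynomial (Fin 2) F)
    (hf : f = X 0 * (X 0 - 1) * (X 0 - X 1))
    (P : ℕ → MvPolynomial (Fin 2) F)
    (hP1 : P 1 = C (1 / 2 : F) * pderiv 0 f)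
    (hPrec : ∀ m : ℕ, 1 ≤ m →
      C ((m : F) + 1) * P (m + 1) =
        pderiv 0 (P m) * f + C ((1 / 2 : F) - (m : F)) * (P m * pderiv 0 f)) :
    ∀ m : ℕ, 2 ≤ m →
      convexHull ℝ
        ((fun d : Fin 2 →₀ ℕ => (((d 0 : ℕ) : ℝ), ((d 1 : ℕ) : ℝ))) ''
          ((P m).support : Set (Fin 2 →₀ ℕ))) =
      convexHull ℝ
        ({((0 : ℝ), (m : ℝ)),
          (((m - 2 : ℕ) : ℝ), (m : ℝ)),
          (((m - 2 : ℕ) : ℝ), (2 : ℝ)),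
          (((2 * m - 1 : ℕ) : ℝ), (1 : ℝ)),
          (((2 * m - 1 : ℕ) : ℝ), (0 : ℝ)),
          (((2 * m : ℕ) : ℝ), (0 : ℝ))} : Set (ℝ × ℝ)) := by
  intro m hm
  let Q : ℕ → MvPolynomial (Fin 2) F := fun n => if n = 0 then 1 else P n
  have hQ : ∀ n : ℕ, C ((n : F) + 1) * Q (n + 1) =
      pderiv 0 (Q n) * f + C ((1 / 2 : F) - (n : F)) * (Q n * pderiv 0 f) := by
    intro n
    rcases Nat.eq_zero_or_pos n with rfl | hn
    · simp [Q, hP1]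
    · simpa [Q, hn.ne'] using hPrec n hn
  have hb : LegendreInflection.IsCoeffTable fun (n : ℕ) (j k : ℤ) =>
      LegendreInflection.extCoeff (2 * n - j - k) j (Q n) := by
    constructor
    · intro j k
      simp only [Q, if_true, LegendreInflection.extCoeff_one]
      congr 1
      apply propext
      push_cast
      omega
    · intro n j k
      have h := congrArg
        (LegendreInflection.extCoeff (2 * ((n + 1 : ℕ) : ℤ) - j - k) j) (hQ n)
      rw [LegendreInflection.extCoeff_C_mul,
        LegendreInflection.extCoeff_inflection_step _ _ _ _ _ hf] at h
      rw [h]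
      have e1 : 2 * ((n + 1 : ℕ) : ℤ) - j - k - 2 = 2 * n - j - k := by push_cast; ring
      have e2 : 2 * ((n + 1 : ℕ) : ℤ) - j - k - 1 = 2 * n - j - (k - 1) := by push_cast; ring
      have e3 : 2 * (n : ℤ) - (j - 1) - k = 2 * n - j - (k - 1) := by ring
      have e4 : 2 * (n : ℤ) - (j - 1) - (k - 1) = 2 * ((n + 1 : ℕ) : ℤ) - j - k := by
        push_cast; ring
      rw [e1, e2, e3, e4]
      push_cast
      ring
  have hQm : Q m = P m := if_neg (by omega)
  apply subset_antisymm
  · refine convexHull_min ?_ (convex_convexHull ℝ _)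
    rintro _ ⟨d, hd, rfl⟩
    set S : Set (ℝ × ℝ) := {((0 : ℝ), (m : ℝ)),
          (((m - 2 : ℕ) : ℝ), (m : ℝ)),
          (((m - 2 : ℕ) : ℝ), (2 : ℝ)),
          (((2 * m - 1 : ℕ) : ℝ), (1 : ℝ)),
          (((2 * m - 1 : ℕ) : ℝ), (0 : ℝ)),
          (((2 * m : ℕ) : ℝ), (0 : ℝ))} with hS
    have hc1 : ((m - 2 : ℕ) : ℝ) = m - 2 := by push_cast [hm]; ring
    have hc2 : ((2 * m - 1 : ℕ) : ℝ) = 2 * m - 1 := by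
      push_cast [show 1 ≤ 2 * m by omega]; ring
    have hT : Convex ℝ {p : ℝ × ℝ | (2 * (m : ℝ) - p.1 - p.2, p.1) ∈ convexHull ℝ S} := by
      intro p hp q hq a c ha hc hac
      have := convex_convexHull ℝ S hp hq ha hc hac
      simp only [Set.mem_ofPred_eq]
      convert this using 1
      ext
      · simp
        linear_combination (-2 * (m : ℝ)) * hac
      · simp
    have hv : ∀ p ∈ S, p ∈ convexHull ℝ S := subset_convexHull ℝ S
    have hne : LegendreInflection.extCoeff
        (2 * m - (d 1 : ℤ) - (2 * m - d 0 - d 1)) (d 1) (Q m) ≠ 0 := by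
      rw [show (2 * m - (d 1 : ℤ) - (2 * m - d 0 - d 1)) = d 0 by ring,
        LegendreInflection.extCoeff_natCast, hQm]
      exact mem_support_iff.mp hd
    have := LegendreInflection.mem_of_convex hT hm
      (by apply hv; simp [hS])
      (by apply hv; simp [hS, hc2])
      (by apply hv; simp [hS, hc2])
      (by apply hv; left; ext <;> simp; ring)
      (by apply hv; right; left; ext <;> simp [hc1]; ring)
      (by apply hv; right; right; left; ext <;> simp [hc1]; ring)
      (hb.mem_of_ne_zero hne)
    simpa using this
  · apply convexHull_mono
    have key : ∀ (i j : ℕ) (k : ℤ), (i : ℤ) = 2 * m - j - k →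
        LegendreInflection.extCoeff (2 * m - (j : ℤ) - k) j (Q m) ≠ 0 →
        ((i : ℝ), (j : ℝ)) ∈
          (fun d : Fin 2 →₀ ℕ => (((d 0 : ℕ) : ℝ), ((d 1 : ℕ) : ℝ))) ''
          ((P m).support : Set (Fin 2 →₀ ℕ)) := by
      intro i j k hi h
      refine ⟨Finsupp.single 0 i + Finsupp.single 1 j, ?_, by simp⟩
      rw [Finset.mem_coe, mem_support_iff, ← LegendreInflection.extCoeff_natCast, ← hQm]
      simpa [hi] using h
    have hm0 : m ≠ 0 := by omega
    rintro p (rfl | rfl | rfl | rfl | rfl | rfl)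
    · exact_mod_cast key 0 m m (by push_cast; ring) (hb.self_self_ne_zero m)
    · exact key (m - 2) m 2 (by omega) (hb.self_two_ne_zero hm)
    · exact_mod_cast key (m - 2) 2 m (by omega) (hb.swap.self_two_ne_zero hm)
    · exact_mod_cast key (2 * m - 1) 1 0 (by omega) (hb.one_zero_ne_zero hm0)
    · exact_mod_cast key (2 * m - 1) 0 1 (by omega) (hb.swap.one_zero_ne_zero hm0)
    · exact_mod_cast key (2 * m) 0 0 (by push_cast; ring) (hb.zero_zero_ne_zero m)
end

section
/- Let F be a field of characteristic zero, let f = x·(x−1)·(x−λ) ∈ F[x, λ], set u = 1/2 ∈ F, and let P_m ∈ F[x, λ] (m ≥ 1) be the atomic inflection polynomials attached to (f, u). Then: (i) for every m ≥ 1, the coefficient of λ^m in P_m equals (u)_m/m! and the coefficient of x^{2m} in P_m equals (3u)_m/m!; (ii) for every m ≥ 2, the coefficient of x^{m−2}·λ^m in P_m and the coefficient of x^{m−2}·λ^2 in P_m both equal −1/8; (iii) for every m ≥ 2, the coefficient of x^{2m−1} in P_m and the coefficient of x^{2m−1}·λ in P_m both equal −(2/(m−1)!)·u·(3u−1)_{m−1};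 and (iv) for every m ≥ 2, the coefficient of x^{2m−2}·λ in P_m equals (1/(m−1)!)·((4m−1)u − m)·u·(3u−2)_{m−2}. -/
open MvPolynomial

/-- The coefficient of `x ^ i * λ ^ j` for integer exponents, which is zero when an exponent is
negative. -/
noncomputable def intCoeff {F : Type*} [Field F] (i j : ℤ) (Q : MvPolynomial (Fin 2) F) : F :=
  if 0 ≤ i ∧ 0 ≤ j then coeff (Finsupp.single 0 i.toNat + Finsupp.single 1 j.toNat) Q else 0

section IntCoeff

variable {F : Type*} [Field F]

theorem intCoeff_natCast (i j : ℕ) (Q : MvPolynomial (Fin 2) F) :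
    intCoeff i j Q = coeff (Finsupp.single 0 i + Finsupp.single 1 j) Q := by
  simp [intCoeff]

theorem intCoeff_add (i j : ℤ) (Q R : MvPolynomial (Fin 2) F) :
    intCoeff i j (Q + R) = intCoeff i j Q + intCoeff i j R := by
  unfold intCoeff; split_ifs <;> simp

theorem intCoeff_sub (i j : ℤ) (Q R : MvPolynomial (Fin 2) F) :
    intCoeff i j (Q - R) = intCoeff i j Q - intCoeff i j R := by
  unfold intCoeff; split_ifs <;> simp

theorem intCoeff_C_mul (i j : ℤ) (a : F) (Q : MvPolynomial (Fin 2) F) :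
    intCoeff i j (C a * Q) = a * intCoeff i j Q := by
  unfold intCoeff; split_ifs <;> simp

theorem intCoeff_one (i j : ℤ) :
    intCoeff i j (1 : MvPolynomial (Fin 2) F) = if i = 0 ∧ j = 0 then 1 else 0 := by
  unfold intCoeff
  rw [coeff_one]
  have key : (0 : Fin 2 →₀ ℕ) = Finsupp.single 0 i.toNat + Finsupp.single 1 j.toNat ↔
      i.toNat = 0 ∧ j.toNat = 0 := by
    simp [Finsupp.ext_iff, Fin.forall_fin_two, eq_comm]
  simp only [key]
  split_ifs <;> first | rfl | omega

theorem intCoeff_X_zero_mul (i j : ℤ) (Q : MvPolynomial (Fin 2) F) :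
    intCoeff i j (X 0 * Q) = intCoeff (i - 1) j Q := by
  by_cases h : 0 ≤ i - 1 ∧ 0 ≤ j
  · obtain ⟨a, ha⟩ := Int.eq_ofNat_of_zero_le h.1
    obtain ⟨b, rfl⟩ := Int.eq_ofNat_of_zero_le h.2
    obtain rfl : i = ((a + 1 : ℕ) : ℤ) := by push_cast; omega
    rw [ha, intCoeff_natCast, intCoeff_natCast, Finsupp.single_add, add_comm (Finsupp.single 0 a),
      add_assoc, coeff_X_mul]
  · rw [intCoeff, intCoeff, if_neg h]
    split_ifs with h'
    · obtain rfl : i = 0 := by omega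
      rw [coeff_X_mul', if_neg (by simp)]
    · rfl

theorem intCoeff_X_one_mul (i j : ℤ) (Q : MvPolynomial (Fin 2) F) :
    intCoeff i j (X 1 * Q) = intCoeff i (j - 1) Q := by
  by_cases h : 0 ≤ i ∧ 0 ≤ j - 1
  · obtain ⟨a, rfl⟩ := Int.eq_ofNat_of_zero_le h.1
    obtain ⟨b, hb⟩ := Int.eq_ofNat_of_zero_le h.2
    obtain rfl : j = ((b + 1 : ℕ) : ℤ) := by push_cast; omega
    rw [hb, intCoeff_natCast, intCoeff_natCast, Finsupp.single_add, add_comm (Finsupp.single 1 b),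
      add_left_comm, coeff_X_mul]
  · rw [intCoeff, intCoeff, if_neg h]
    split_ifs with h'
    · obtain rfl : j = 0 := by omega
      rw [coeff_X_mul', if_neg (by simp)]
    · rfl

theorem coeff_pderiv_zero (a b : ℕ) (Q : MvPolynomial (Fin 2) F) :
    coeff (Finsupp.single 0 a + Finsupp.single 1 b) (pderiv 0 Q) =
      ((a : F) + 1) * coeff (Finsupp.single 0 (a + 1) + Finsupp.single 1 b) Q := by
  rw [coeff_pderiv, Finsupp.single_add, add_right_comm, mul_comm]
  simp

theorem intCoeff_pderiv_zero (i j : ℤ) (Q : MvPolynomial (Fin 2) F) :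
    intCoeff i j (pderiv 0 Q) = ((i : F) + 1) * intCoeff (i + 1) j Q := by
  by_cases h : 0 ≤ i ∧ 0 ≤ j
  · obtain ⟨a, rfl⟩ := Int.eq_ofNat_of_zero_le h.1
    obtain ⟨b, rfl⟩ := Int.eq_ofNat_of_zero_le h.2
    rw [intCoeff_natCast, coeff_pderiv_zero, ← intCoeff_natCast]
    push_cast
    rfl
  · rw [intCoeff, intCoeff, if_neg h]
    split_ifs with h'
    · obtain rfl : i = -1 := by omega
      simp
    · simp

theorem intCoeff_inflection_step (i j : ℤ) (w : F) (Q : MvPolynomial (Fin 2) F) :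
    intCoeff i j (pderiv 0 Q * (X 0 * (X 0 - 1) * (X 0 - X 1)) +
      C w * (Q * pderiv 0 (X 0 * (X 0 - 1) * (X 0 - X 1)))) =
    (i - 2 + 3 * w) * intCoeff (i - 2) j Q
      - (i - 1 + 2 * w) * (intCoeff (i - 1) j Q + intCoeff (i - 1) (j - 1) Q)
      + (i + w) * intCoeff i (j - 1) Q := by
  have hd : pderiv 0 (X 0 * (X 0 - 1) * (X 0 - X 1) : MvPolynomial (Fin 2) F) =
      C 3 * (X 0 * X 0) - C 2 * X 0 - C 2 * (X 0 * X 1) + X 1 := by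
    simp only [Derivation.leibniz, map_sub, pderiv_X_self, Derivation.map_one_eq_zero,
      pderiv_X_of_ne (show (1 : Fin 2) ≠ 0 by decide), smul_eq_mul, map_ofNat]
    ring
  have expand : pderiv 0 Q * (X 0 * (X 0 - 1) * (X 0 - X 1)) +
      C w * (Q * pderiv 0 (X 0 * (X 0 - 1) * (X 0 - X 1))) =
      X 0 * (X 0 * (X 0 * pderiv 0 Q)) - X 0 * (X 0 * pderiv 0 Q)
        - X 1 * (X 0 * (X 0 * pderiv 0 Q)) + X 1 * (X 0 * pderiv 0 Q)
        + C w * (C 3 * (X 0 * (X 0 * Q)) - C 2 * (X 0 * Q) - C 2 * (X 1 * (X 0 * Q)) + X 1 * Q) := by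
    rw [hd]; ring
  rw [expand]
  simp only [intCoeff_add, intCoeff_sub, intCoeff_C_mul, intCoeff_X_zero_mul, intCoeff_X_one_mul,
    intCoeff_pderiv_zero]
  have e1 : i - 1 - 1 = i - 2 := by ring
  have e2 : i - 1 - 1 - 1 + 1 = i - 2 := by ring
  have e3 : i - 1 - 1 + 1 = i - 1 := by ring
  have e4 : i - 1 + 1 = i := by ring
  rw [e2, e3, e4, e1]
  push_cast
  ring

end IntCoeff

theorem fallingFactorial_succ {F : Type*} [Field F] (w : F) (k : ℕ) :
    fallingFactorial w (k + 1) = fallingFactorial w k * (w - k) :=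
  Finset.prod_range_succ _ _

theorem fallingFactorial_succ_left {F : Type*} [Field F] (w : F) (k : ℕ) :
    fallingFactorial w (k + 1) = w * fallingFactorial (w - 1) k := by
  rw [fallingFactorial, Finset.prod_range_succ', mul_comm]
  simp [fallingFactorial, sub_sub, add_comm]

/-- The coefficients `p m i j` of `x ^ i * λ ^ j` in the atomic inflection polynomials of the
Legendre pencil, characterized by their recursion, starting from the constant polynomial `1`. -/
structure IsLegendreInflectionArray {F : Type*} [Field F] (u : F) (p : ℕ → ℤ → ℤ → F) : Prop where
  zero : ∀ i j, p 0 i j = if i = 0 ∧ j = 0 then 1 else 0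
  step : ∀ (m : ℕ) (i j : ℤ), ((m : F) + 1) * p (m + 1) i j =
    (i - 2 + 3 * (u - m)) * p m (i - 2) j
      - (i - 1 + 2 * (u - m)) * (p m (i - 1) j + p m (i - 1) (j - 1))
      + (i + (u - m)) * p m i (j - 1)

namespace IsLegendreInflectionArray

variable {F : Type*} [Field F] [CharZero F] {u : F} {p : ℕ → ℤ → ℤ → F}

theorem eq_zero (h : IsLegendreInflectionArray u p) (m : ℕ) : ∀ i j : ℤ,
    (i < 0 ∨ j < 0 ∨ (m : ℤ) < j ∨ i + j < m ∨ 2 * (m : ℤ) < i + j) → p m i j = 0 := by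
  induction m with
  | zero => intro i j hij; rw [h.zero, if_neg]; push_cast at hij; omega
  | succ m ih =>
    intro i j hij
    push_cast at hij
    have hs := h.step m i j
    rw [ih (i - 2) j (by omega), ih (i - 1) j (by omega), ih (i - 1) (j - 1) (by omega),
      ih i (j - 1) (by omega)] at hs
    simpa [Nat.cast_add_one_ne_zero] using hs

theorem apply_zero_self (h : IsLegendreInflectionArray u p) (m : ℕ) :
    p m 0 m = fallingFactorial u m / (m.factorial : F) := by
  induction m with
  | zero => simp [h.zero, fallingFactorial]
  | succ m ih =>
    have hs := h.step m 0 (m + 1)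
    rw [h.eq_zero m (0 - 2) _ (by omega), h.eq_zero m (0 - 1) _ (by omega),
      h.eq_zero m (0 - 1) _ (by omega), add_sub_cancel_right, ih] at hs
    have hm : (m : F) + 1 ≠ 0 := Nat.cast_add_one_ne_zero m
    have hf : (m.factorial : F) ≠ 0 := Nat.cast_ne_zero.2 m.factorial_ne_zero
    rw [fallingFactorial_succ, Nat.factorial_succ]
    push_cast at hs ⊢
    field_simp at hs ⊢
    linear_combination hs

theorem apply_two_mul_zero (h : IsLegendreInflectionArray u p) (m : ℕ) :
    p m (2 * m) 0 = fallingFactorial (3 * u) m / (m.factorial : F) := by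
  induction m with
  | zero => simp [h.zero, fallingFactorial]
  | succ m ih =>
    have hs := h.step m (2 * m + 2) 0
    rw [h.eq_zero m (2 * m + 2 - 1) _ (by omega), h.eq_zero m (2 * m + 2 - 1) _ (by omega),
      h.eq_zero m (2 * m + 2) (0 - 1) (by omega), add_sub_cancel_right, ih] at hs
    have hm : (m : F) + 1 ≠ 0 := Nat.cast_add_one_ne_zero m
    have hf : (m.factorial : F) ≠ 0 := Nat.cast_ne_zero.2 m.factorial_ne_zero
    rw [fallingFactorial_succ, Nat.factorial_succ,
      show (2 * ((m + 1 : ℕ) : ℤ)) = 2 * m + 2 by push_cast; ring]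
    push_cast at hs ⊢
    field_simp at hs ⊢
    linear_combination hs

/-- The coefficients of `x ^ (2 * m + 1)` and of `x ^ (2 * m + 1) * λ` in the polynomial of index
`m + 1`. -/
theorem apply_two_mul_add_one (h : IsLegendreInflectionArray u p) (m : ℕ) {j : ℤ}
    (hj : j = 0 ∨ j = 1) :
    p (m + 1) (2 * m + 1) j =
      -(2 / (m.factorial : F)) * u * fallingFactorial (3 * u - 1) m := by
  have key (m : ℕ) : ((m : F) + 1) * p (m + 1) (2 * m + 1) j =
      (3 * u - 1 - m) * p m (2 * m - 1) j - 2 * u * p m (2 * m) 0 := by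
    have hs := h.step m (2 * m + 1) j
    rw [show (2 * (m : ℤ) + 1 - 2) = 2 * m - 1 by ring, add_sub_cancel_right,
      h.eq_zero m (2 * m + 1) (j - 1) (by omega)] at hs
    rcases hj with rfl | rfl
    · rw [h.eq_zero m (2 * m) (0 - 1) (by omega)] at hs
      push_cast at hs
      linear_combination hs
    · rw [h.eq_zero m (2 * m) 1 (by omega), sub_self] at hs
      push_cast at hs
      linear_combination hs
  induction m with
  | zero =>
    have hs := key 0
    rw [h.eq_zero 0 _ j (by left; norm_num), h.apply_two_mul_zero] at hs
    simpa [fallingFactorial] using hs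
  | succ m ih =>
    have hs := key (m + 1)
    have hm : (m : F) + 1 ≠ 0 := Nat.cast_add_one_ne_zero m
    have hm' : (m : F) + 1 + 1 ≠ 0 := by exact_mod_cast Nat.cast_add_one_ne_zero (R := F) (m + 1)
    have hf : (m.factorial : F) ≠ 0 := Nat.cast_ne_zero.2 m.factorial_ne_zero
    rw [show (2 * ((m + 1 : ℕ) : ℤ) - 1) = 2 * m + 1 by push_cast; ring, ih,
      h.apply_two_mul_zero, fallingFactorial_succ_left, Nat.factorial_succ] at hs
    rw [fallingFactorial_succ, Nat.factorial_succ]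
    apply mul_left_cancel₀ hm'
    push_cast at hs ⊢
    rw [hs]
    field_simp
    ring

theorem two_eq_zero (h : IsLegendreInflectionArray (1 / 2 : F) p) {i j : ℤ}
    (hij : i ≠ 0 ∧ i + j = 2 ∨ i ≠ 0 ∧ j = 2) : p 2 i j = 0 := by
  by_cases hi : i < 0
  · exact h.eq_zero 2 i j (by omega)
  by_cases hj : j < 0
  · exact h.eq_zero 2 i j (by omega)
  by_cases hk : 4 < i + j
  · exact h.eq_zero 2 i j (by push_cast; omega)
  have hs := h.step 1 i j
  have h1 (i j : ℤ) := h.step 0 i j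
  simp only [Nat.cast_zero, zero_add, one_mul, h.zero] at h1
  simp only [h1] at hs
  have : (i = 1 ∧ j = 1) ∨ (i = 2 ∧ j = 0) ∨ (i = 1 ∧ j = 2) ∨ (i = 2 ∧ j = 2) := by omega
  rcases this with ⟨rfl, rfl⟩ | ⟨rfl, rfl⟩ | ⟨rfl, rfl⟩ | ⟨rfl, rfl⟩ <;> norm_num at hs <;> exact hs

theorem half_apply_lambda_top (h : IsLegendreInflectionArray (1 / 2 : F) p) (m : ℕ) :
    p (m + 2) m (m + 2) = -(1 / 8) ∧ ∀ i : ℤ, m < i → p (m + 2) i (m + 2) = 0 := by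
  induction m with
  | zero =>
    refine ⟨?_, fun i hi => h.two_eq_zero (Or.inr ⟨by omega, by simp⟩)⟩
    have := h.apply_zero_self 2
    norm_num [fallingFactorial, Finset.prod_range_succ] at this ⊢
    exact this
  | succ m ih =>
    have hm : ((m + 2 : ℕ) : F) + 1 ≠ 0 := Nat.cast_add_one_ne_zero _
    have key (i : ℤ) (hi : m < i) : (((m + 2 : ℕ) : F) + 1) * p (m + 1 + 2) i ((m + 1 : ℕ) + 2) =
        -(i - 1 + 2 * (1 / 2 - ((m + 2 : ℕ) : F))) * p (m + 2) (i - 1) (m + 2) := by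
      have hs := h.step (m + 2) i ((m + 1 : ℕ) + 2)
      rw [h.eq_zero (m + 2) (i - 2) ((m + 1 : ℕ) + 2) (by push_cast; omega),
        h.eq_zero (m + 2) (i - 1) ((m + 1 : ℕ) + 2) (by push_cast; omega),
        show ((m + 1 : ℕ) + 2 - 1 : ℤ) = m + 2 by push_cast; ring, ih.2 i hi] at hs
      linear_combination hs
    constructor
    · apply mul_left_cancel₀ hm
      rw [key _ (by push_cast; omega), show ((m + 1 : ℕ) - 1 : ℤ) = m by push_cast; ring, ih.1]
      push_cast
      ring
    · intro i hi
      push_cast at hi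
      have := key i (by omega)
      rw [ih.2 (i - 1) (by omega), mul_zero] at this
      exact (mul_eq_zero.1 this).resolve_left hm

theorem half_apply_degree_bot (h : IsLegendreInflectionArray (1 / 2 : F) p) (m : ℕ) :
    p (m + 2) m 2 = -(1 / 8) ∧ p (m + 2) (m + 1) 1 = 0 ∧ p (m + 2) (m + 2) 0 = 0 := by
  induction m with
  | zero =>
    refine ⟨?_, h.two_eq_zero (by omega), h.two_eq_zero (by omega)⟩
    simpa using (h.half_apply_lambda_top 0).1
  | succ m ih =>
    obtain ⟨h2, h1, h0⟩ := ih
    have hm : ((m + 2 : ℕ) : F) + 1 ≠ 0 := Nat.cast_add_one_ne_zero _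
    have key (i j : ℤ) (hij : i + j = m + 3) : (((m + 2 : ℕ) : F) + 1) * p (m + 1 + 2) i j =
        -(i - 1 + 2 * (1 / 2 - ((m + 2 : ℕ) : F))) * p (m + 2) (i - 1) j
        + (i + (1 / 2 - ((m + 2 : ℕ) : F))) * p (m + 2) i (j - 1) := by
      have hs := h.step (m + 2) i j
      rw [h.eq_zero (m + 2) (i - 2) j (by push_cast; omega),
        h.eq_zero (m + 2) (i - 1) (j - 1) (by push_cast; omega)] at hs
      linear_combination hs
    push_cast at key hm ⊢
    refine ⟨?_, ?_, ?_⟩ <;> apply mul_left_cancel₀ hm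
    · rw [key _ _ (by ring), add_sub_cancel_right, h2, show (2 - 1 : ℤ) = 1 by norm_num, h1]
      push_cast
      ring
    · rw [key _ _ (by ring), add_sub_cancel_right, h1, sub_self,
        show (m + 1 + 1 : ℤ) = m + 2 by ring, h0]
      ring
    · rw [key _ _ (by ring), show (m + 1 + 2 - 1 : ℤ) = m + 2 by ring, h0,
        h.eq_zero (m + 2) _ (0 - 1) (by omega)]
      ring

theorem half_apply_interior (h : IsLegendreInflectionArray (1 / 2 : F) p) (m : ℕ) :
    p (m + 2) (2 * m + 2) 1 = 1 / ((m + 1).factorial : F) *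
      ((4 * ((m : F) + 2) - 1) * (1 / 2) - ((m : F) + 2)) * (1 / 2) *
        fallingFactorial (3 * (1 / 2) - 2) m := by
  have key (m : ℕ) : ((m : F) + 1) * p (m + 1) (2 * m) 1 =
      (3 * (1 / 2) - 2 - m) * p m (2 * m - 2) 1 + (m + 1 / 2) * p m (2 * m) 0 := by
    have hs := h.step m (2 * m) 1
    rw [sub_self] at hs
    push_cast at hs
    linear_combination hs
  induction m with
  | zero =>
    have hs := key 1
    have h1 := h.apply_zero_self 1
    rw [h.apply_two_mul_zero] at hs
    norm_num [fallingFactorial, Finset.prod_range_succ] at hs h1 ⊢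
    rw [h1] at hs
    linear_combination hs / 2
  | succ m ih =>
    have hs := key (m + 2)
    have hm : (m : F) + 1 ≠ 0 := Nat.cast_add_one_ne_zero m
    have hm' : (m : F) + 2 ≠ 0 := by exact_mod_cast Nat.cast_add_one_ne_zero (R := F) (m + 1)
    have hm'' : (m : F) + 2 + 1 ≠ 0 := by exact_mod_cast Nat.cast_add_one_ne_zero (R := F) (m + 2)
    have hf : (m.factorial : F) ≠ 0 := Nat.cast_ne_zero.2 m.factorial_ne_zero
    rw [show (2 * ((m + 2 : ℕ) : ℤ) - 2) = 2 * m + 2 by push_cast; ring, ih,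
      h.apply_two_mul_zero, fallingFactorial_succ_left, fallingFactorial_succ_left,
      show (3 * (1 / 2) - 1 - 1 : F) = 3 * (1 / 2) - 2 by ring,
      Nat.factorial_succ (m + 1), Nat.factorial_succ m] at hs
    rw [fallingFactorial_succ, Nat.factorial_succ (m + 1), Nat.factorial_succ m,
      show (2 * ((m + 1 : ℕ) : ℤ) + 2) = 2 * (m + 2 : ℕ) by push_cast; ring]
    push_cast at hs ⊢
    apply mul_left_cancel₀ hm''
    rw [hs, show (m + 1 + 1 : F) = m + 2 by ring]
    field_simp
    ring

end IsLegendreInflectionArray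

/-- Explicit coefficients of the atomic inflection polynomials of
the Legendre pencil `y^n = x(x-1)(x-λ)` with `u = 1/2` at the vertices of their
Newton polygons, and at the distinguished interior point `(2m-2, 1)`. -/
theorem legendre_inflection_coefficients_u_half
    (F : Type*) [Field F] [CharZero F]
    (u : F) (hu : u = 1 / 2)
    (f : MvPolynomial (Fin 2) F)
    (hf : f = X 0 * (X 0 - 1) * (X 0 - X 1))
    (P : ℕ → MvPolynomial (Fin 2) F)
    (hP1 : P 1 = C u * pderiv 0 f)
    (hPrec : ∀ m : ℕ, 1 ≤ m →
      C ((m : F) + 1) * P (m + 1) =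
        pderiv 0 (P m) * f + C (u - (m : F)) * (P m * pderiv 0 f)) :
    (∀ m : ℕ, 1 ≤ m →
      coeff (Finsupp.single (1 : Fin 2) m) (P m) =
        fallingFactorial u m / (m.factorial : F) ∧
      coeff (Finsupp.single (0 : Fin 2) (2 * m)) (P m) =
        fallingFactorial (3 * u) m / (m.factorial : F)) ∧
    (∀ m : ℕ, 2 ≤ m →
      coeff (Finsupp.single (0 : Fin 2) (m - 2) + Finsupp.single 1 m) (P m) = -(1 / 8) ∧
      coeff (Finsupp.single (0 : Fin 2) (m - 2) + Finsupp.single 1 2) (P m) = -(1 / 8)) ∧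
    (∀ m : ℕ, 2 ≤ m →
      coeff (Finsupp.single (0 : Fin 2) (2 * m - 1)) (P m) =
        -(2 / ((m - 1).factorial : F)) * u * fallingFactorial (3 * u - 1) (m - 1) ∧
      coeff (Finsupp.single (0 : Fin 2) (2 * m - 1) + Finsupp.single 1 1) (P m) =
        -(2 / ((m - 1).factorial : F)) * u * fallingFactorial (3 * u - 1) (m - 1)) ∧
    (∀ m : ℕ, 2 ≤ m →
      coeff (Finsupp.single (0 : Fin 2) (2 * m - 2) + Finsupp.single 1 1) (P m) =
        1 / ((m - 1).factorial : F) * ((4 * (m : F) - 1) * u - (m : F)) * u *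
          fallingFactorial (3 * u - 2) (m - 2)) := by
  subst hu hf
  have harr : IsLegendreInflectionArray (1 / 2 : F)
      (fun m i j => intCoeff i j (if m = 0 then 1 else P m)) := by
    refine ⟨fun i j => by simpa using intCoeff_one i j, fun m i j => ?_⟩
    rw [← intCoeff_inflection_step, ← intCoeff_C_mul]
    congr 1
    rcases Nat.eq_zero_or_pos m with rfl | hm
    · simp [hP1]
    · simpa [hm.ne'] using hPrec m hm
  refine ⟨fun m hm => ⟨?_, ?_⟩, fun m hm => ?_, fun m hm => ?_, fun m hm => ?_⟩
  · have := harr.apply_zero_self m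
    have e := intCoeff_natCast 0 m (P m)
    simp only [if_neg (show m ≠ 0 by omega)] at this
    simp only [Nat.cast_zero, Finsupp.single_zero, zero_add] at e
    rw [← e, this]
  · have := harr.apply_two_mul_zero m
    have e := intCoeff_natCast (2 * m) 0 (P m)
    simp only [if_neg (show m ≠ 0 by omega)] at this
    simp only [Nat.cast_zero, Finsupp.single_zero, add_zero, Nat.cast_mul, Nat.cast_ofNat] at e
    rw [← e, this]
  · obtain ⟨k, rfl⟩ := Nat.exists_eq_add_of_le' hm
    rw [Nat.add_sub_cancel, ← intCoeff_natCast, ← intCoeff_natCast]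
    have ht := (harr.half_apply_lambda_top k).1
    have hb := (harr.half_apply_degree_bot k).1
    simp only [if_neg (show k + 2 ≠ 0 by omega)] at ht hb
    push_cast
    exact ⟨ht, hb⟩
  · obtain ⟨k, rfl⟩ := Nat.exists_eq_add_of_le' (show 1 ≤ m by omega)
    have h0 := harr.apply_two_mul_add_one k (Or.inl rfl)
    have h1 := harr.apply_two_mul_add_one k (Or.inr rfl)
    have e0 := intCoeff_natCast (2 * k + 1) 0 (P (k + 1))
    have e1 := intCoeff_natCast (2 * k + 1) 1 (P (k + 1))
    simp only [if_neg (show k + 1 ≠ 0 by omega)] at h0 h1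
    simp only [Finsupp.single_zero, add_zero] at e0
    rw [show 2 * (k + 1) - 1 = 2 * k + 1 by omega, Nat.add_sub_cancel, ← e0, ← e1]
    push_cast
    exact ⟨h0, h1⟩
  · obtain ⟨k, rfl⟩ := Nat.exists_eq_add_of_le' hm
    have hi := harr.half_apply_interior k
    simp only [if_neg (show k + 2 ≠ 0 by omega)] at hi
    rw [show 2 * (k + 2) - 2 = 2 * k + 2 by omega, Nat.add_sub_cancel,
      show k + 2 - 1 = k + 1 by omega, ← intCoeff_natCast]
    push_cast
    exact hi
end

section
/- Let F be a field of characteristic zero, u ∈ F, let f = x^5 + x^3 + s·x ∈ F[x, s], and let P_m ∈ F[x, s] (m ≥ 1) be the atomic inflection polynomials attached to (f, u) (with derivative taken in x). Then: (i) for every m ≥ 1 and every pair (i, j) in the support of P_m one has 2m ≤ i + 2j and i + 4j ≤ 4m (i.e., the support lies in the triangle with vertices (0, m), (2m, 0), (4m, 0)); (ii) for every m ≥ 1, the coefficient of s^m in P_m equals (u)_m/m!, the coefficient of x^{2m} in P_m equals (3u)_m/m!, and the coefficient of x^{4m} in P_m equals (5u)_m/m!; (iii) if moreover u is not an integer multiple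 of 1/3 nor of 1/5 in F (that is, 3u ≠ k·1_F and 5u ≠ k·1_F for every integer k), then for every m ≥ 2 the convex hull in ℝ² of the support of P_m equals the convex hull of the three points (0, m), (2m, 0), (4m, 0). -/
open MvPolynomial

theorem fallingFactorial_ne_zero {F : Type*} [Field F] {w : F} (hw : ∀ k : ℤ, w ≠ k) (n : ℕ) :
    fallingFactorial w n ≠ 0 :=
  Finset.prod_ne_zero_iff.2 fun i _ => sub_ne_zero.2 (by simpa using hw i)

/-- The coefficients of the Euler derivative `x · ∂p/∂x`. -/
theorem coeff_pderiv_mul_X {σ R : Type*} [CommSemiring R] (p : MvPolynomial σ R) (i : σ)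
    (d : σ →₀ ℕ) : coeff d (pderiv i p * X i) = d i * coeff d p := by
  classical
  induction p using MvPolynomial.induction_on' with
  | monomial e a =>
    rw [mul_comm, X_mul_pderiv_monomial, coeff_smul, coeff_monomial, nsmul_eq_mul]
    split_ifs with h
    · rw [h]
    · simp
  | add p q hp hq => rw [map_add, add_mul, coeff_add, hp, hq, coeff_add, mul_add]

theorem coeff_mul_X_zero_pow {R : Type*} [CommSemiring R] (p : MvPolynomial (Fin 2) R)
    (k i j : ℕ) :
    coeff (Finsupp.single 0 i + Finsupp.single 1 j) (p * X 0 ^ k) =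
      if k ≤ i then coeff (Finsupp.single 0 (i - k) + Finsupp.single 1 j) p else 0 := by
  have hle : Finsupp.single (0 : Fin 2) k ≤ Finsupp.single 0 i + Finsupp.single 1 j ↔ k ≤ i := by
    simp [Finsupp.le_def, Fin.forall_fin_two]
  have hsub : Finsupp.single (0 : Fin 2) i + Finsupp.single 1 j - Finsupp.single 0 k =
      Finsupp.single 0 (i - k) + Finsupp.single 1 j := by
    ext a
    fin_cases a <;> simp
  rw [X_pow_eq_monomial, coeff_mul_monomial', hsub, mul_one]
  simp only [hle]

theorem coeff_mul_X_one {R : Type*} [CommSemiring R] (p : MvPolynomial (Fin 2) R) (i j : ℕ) :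
    coeff (Finsupp.single 0 i + Finsupp.single 1 j) (p * X 1) =
      if 1 ≤ j then coeff (Finsupp.single 0 i + Finsupp.single 1 (j - 1)) p else 0 := by
  have hle : Finsupp.single (1 : Fin 2) 1 ≤ Finsupp.single 0 i + Finsupp.single 1 j ↔ 1 ≤ j := by
    simp [Finsupp.le_def, Fin.forall_fin_two]
  have hsub : Finsupp.single (0 : Fin 2) i + Finsupp.single 1 j - Finsupp.single 1 1 =
      Finsupp.single 0 i + Finsupp.single 1 (j - 1) := by
    ext a
    fin_cases a <;> simp
  rw [X, coeff_mul_monomial', hsub, mul_one]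
  simp only [hle]

theorem pderiv_zero_D4 (R : Type*) [CommRing R] :
    pderiv 0 (X 0 ^ 5 + X 0 ^ 3 + X 1 * X 0 : MvPolynomial (Fin 2) R) =
      5 * X 0 ^ 4 + 3 * X 0 ^ 2 + X 1 := by
  simp [pderiv_X_of_ne (show (1 : Fin 2) ≠ 0 by decide)]

/-- The coefficientwise form of the recursion step for `f = x^5 + x^3 + sx`. -/
theorem coeff_D4_step {R : Type*} [CommRing R] (p : MvPolynomial (Fin 2) R) (a : R) (i j : ℕ) :
    coeff (Finsupp.single 0 i + Finsupp.single 1 j)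
      (pderiv 0 p * (X 0 ^ 5 + X 0 ^ 3 + X 1 * X 0) +
        C a * (p * pderiv 0 (X 0 ^ 5 + X 0 ^ 3 + X 1 * X 0))) =
      (if 4 ≤ i then
        (((i - 4 : ℕ) : R) + 5 * a) * coeff (Finsupp.single 0 (i - 4) + Finsupp.single 1 j) p
        else 0) +
      (if 2 ≤ i then
        (((i - 2 : ℕ) : R) + 3 * a) * coeff (Finsupp.single 0 (i - 2) + Finsupp.single 1 j) p
        else 0) +
      (if 1 ≤ j then
        ((i : R) + a) * coeff (Finsupp.single 0 i + Finsupp.single 1 (j - 1)) p else 0) := by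
  have key : pderiv 0 p * (X 0 ^ 5 + X 0 ^ 3 + X 1 * X 0) +
      C a * (p * pderiv 0 (X 0 ^ 5 + X 0 ^ 3 + X 1 * X 0)) =
      (pderiv 0 p * X 0 + C (5 * a) * p) * X 0 ^ 4 +
      (pderiv 0 p * X 0 + C (3 * a) * p) * X 0 ^ 2 +
      (pderiv 0 p * X 0 + C a * p) * X 1 := by
    rw [pderiv_zero_D4, C_mul, C_mul, show (C 5 : MvPolynomial (Fin 2) R) = 5 from map_ofNat C 5,
      show (C 3 : MvPolynomial (Fin 2) R) = 3 from map_ofNat C 3]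
    ring
  have hc (b : R) (k l : ℕ) : coeff (Finsupp.single 0 k + Finsupp.single 1 l)
      (pderiv 0 p * X 0 + C b * p) =
      ((k : R) + b) * coeff (Finsupp.single 0 k + Finsupp.single 1 l) p := by
    rw [coeff_add, coeff_pderiv_mul_X, coeff_C_mul]
    simp [add_mul]
  rw [key, coeff_add, coeff_add, coeff_mul_X_zero_pow, coeff_mul_X_zero_pow, coeff_mul_X_one,
    hc, hc, hc]

theorem mem_convexHull_D4_triangle {m i j : ℝ} (hm : 0 < m) (hj : 0 ≤ j)
    (h₁ : 2 * m ≤ i + 2 * j) (h₂ : i + 4 * j ≤ 4 * m) :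
    (i, j) ∈ convexHull ℝ ({(0, m), (2 * m, 0), (4 * m, 0)} : Set (ℝ × ℝ)) := by
  have hmem := (convex_convexHull ℝ
    ({(0, m), (2 * m, 0), (4 * m, 0)} : Set (ℝ × ℝ))).sum_mem (t := Finset.univ)
    (w := ![j / m, (4 * m - i - 4 * j) / (2 * m), (i + 2 * j - 2 * m) / (2 * m)])
    (z := ![(0, m), (2 * m, 0), (4 * m, 0)])
    (by
      intro a _
      fin_cases a
      · exact div_nonneg hj hm.le
      · exact div_nonneg (by linarith) (by linarith)
      · exact div_nonneg (by linarith) (by linarith))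
    (by
      simp only [Fin.sum_univ_three, Matrix.cons_val]
      field_simp
      ring)
    (by
      intro a _
      apply subset_convexHull
      fin_cases a <;> simp)
  convert hmem using 1
  simp only [Fin.sum_univ_three, Matrix.cons_val, Prod.smul_mk, Prod.mk_add_mk, smul_eq_mul,
    Prod.mk.injEq]
  constructor
  · field_simp
    ring
  · field_simp
    ring

/-- For the atomic inflection polynomials of the D₄ pencil
`y^n = x^5 + x^3 + sx`: (i) the support of `P_m` lies in the triangle with vertices
`(0,m)`, `(2m,0)`, `(4m,0)`; (ii) the coefficients at these three vertices are the
stated normalized falling factorials; (iii) if `u` is not an integer multiple of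
`1/3` nor of `1/5`, the Newton polygon of `P_m` (`m ≥ 2`) is exactly that triangle. -/
theorem D4_inflection_newton_polygon
    (F : Type*) [Field F] [CharZero F]
    (u : F)
    (f : MvPolynomial (Fin 2) F)
    (hf : f = X 0 ^ 5 + X 0 ^ 3 + X 1 * X 0)
    (P : ℕ → MvPolynomial (Fin 2) F)
    (hP1 : P 1 = C u * pderiv 0 f)
    (hPrec : ∀ m : ℕ, 1 ≤ m →
      C ((m : F) + 1) * P (m + 1) =
        pderiv 0 (P m) * f + C (u - (m : F)) * (P m * pderiv 0 f)) :
    (∀ m : ℕ, 1 ≤ m → ∀ i j : ℕ,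
      coeff (Finsupp.single (0 : Fin 2) i + Finsupp.single 1 j) (P m) ≠ 0 →
      2 * m ≤ i + 2 * j ∧ i + 4 * j ≤ 4 * m) ∧
    (∀ m : ℕ, 1 ≤ m →
      coeff (Finsupp.single (1 : Fin 2) m) (P m) =
        fallingFactorial u m / (m.factorial : F) ∧
      coeff (Finsupp.single (0 : Fin 2) (2 * m)) (P m) =
        fallingFactorial (3 * u) m / (m.factorial : F) ∧
      coeff (Finsupp.single (0 : Fin 2) (4 * m)) (P m) =
        fallingFactorial (5 * u) m / (m.factorial : F)) ∧
    ((∀ k : ℤ, 3 * u ≠ (k : F) ∧ 5 * u ≠ (k : F)) →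
      ∀ m : ℕ, 2 ≤ m →
        convexHull ℝ
          ((fun d : Fin 2 →₀ ℕ => (((d 0 : ℕ) : ℝ), ((d 1 : ℕ) : ℝ))) ''
            ((P m).support : Set (Fin 2 →₀ ℕ))) =
        convexHull ℝ
          ({((0 : ℝ), (m : ℝ)),
            ((2 * (m : ℝ)), (0 : ℝ)),
            ((4 * (m : ℝ)), (0 : ℝ))} : Set (ℝ × ℝ))) := by
  subst hf
  set c : ℕ → ℕ → ℕ → F := fun m i j =>
    coeff (Finsupp.single (0 : Fin 2) i + Finsupp.single 1 j) (P m) with hc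
  have hne (m : ℕ) : (m : F) + 1 ≠ 0 := Nat.cast_add_one_ne_zero m
  have hc1 (i j : ℕ) : c 1 i j =
      (if i = 4 ∧ j = 0 then 5 * u else 0) + (if i = 2 ∧ j = 0 then 3 * u else 0) +
        (if i = 0 ∧ j = 1 then u else 0) := by
    have h := coeff_D4_step (1 : MvPolynomial (Fin 2) F) u i j
    have h1 (k l : ℕ) : coeff (Finsupp.single (0 : Fin 2) k + Finsupp.single 1 l)
        (1 : MvPolynomial (Fin 2) F) = if k = 0 ∧ l = 0 then 1 else 0 := by
      rw [coeff_one]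
      congr 1
      simp [Finsupp.ext_iff, Fin.forall_fin_two, eq_comm]
    simp only [pderiv_one, zero_mul, zero_add, one_mul, h1, ← hP1] at h
    refine h.trans ?_
    congr 1
    · congr 1
      · split_ifs <;> first | omega | simp_all
      · split_ifs <;> first | omega | simp_all
    · split_ifs <;> first | omega | simp_all
  have hstep (m : ℕ) (hm : 1 ≤ m) (i j : ℕ) : ((m : F) + 1) * c (m + 1) i j =
      (if 4 ≤ i then (((i - 4 : ℕ) : F) + 5 * (u - m)) * c m (i - 4) j else 0) +
      (if 2 ≤ i then (((i - 2 : ℕ) : F) + 3 * (u - m)) * c m (i - 2) j else 0) +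
      (if 1 ≤ j then ((i : F) + (u - m)) * c m i (j - 1) else 0) := by
    rw [← coeff_D4_step, ← hPrec m hm, coeff_C_mul]
  have hsupp (m : ℕ) (hm : 1 ≤ m) :
      ∀ i j, c m i j ≠ 0 → 2 * m ≤ i + 2 * j ∧ i + 4 * j ≤ 4 * m := by
    induction m, hm using Nat.le_induction with
    | base =>
      intro i j h
      by_contra hlt
      refine h ?_
      rw [hc1, if_neg (by omega), if_neg (by omega), if_neg (by omega)]
      simp
    | succ m hm ih =>
      intro i j h
      by_contra hlt
      have hz (k l : ℕ) (hkl : ¬(2 * m ≤ k + 2 * l ∧ k + 4 * l ≤ 4 * m)) : c m k l = 0 :=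
        not_not.1 (mt (ih k l) hkl)
      refine h ((mul_eq_zero.1 ?_).resolve_left (hne m))
      rw [hstep m hm]
      have e1 : (if 4 ≤ i then (((i - 4 : ℕ) : F) + 5 * (u - m)) * c m (i - 4) j else 0) = 0 := by
        split_ifs
        · rw [hz _ _ (by omega), mul_zero]
        · rfl
      have e2 : (if 2 ≤ i then (((i - 2 : ℕ) : F) + 3 * (u - m)) * c m (i - 2) j else 0) = 0 := by
        split_ifs
        · rw [hz _ _ (by omega), mul_zero]
        · rfl
      have e3 : (if 1 ≤ j then ((i : F) + (u - m)) * c m i (j - 1) else 0) = 0 := by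
        split_ifs
        · rw [hz _ _ (by omega), mul_zero]
        · rfl
      rw [e1, e2, e3]
      simp
  have hz (m : ℕ) (hm : 1 ≤ m) (k l : ℕ) (hkl : ¬(2 * m ≤ k + 2 * l ∧ k + 4 * l ≤ 4 * m)) :
      c m k l = 0 := not_not.1 (mt (hsupp m hm k l) hkl)
  have hvert (m : ℕ) (hm : 1 ≤ m) :
      c m 0 m = fallingFactorial u m / (m.factorial : F) ∧
      c m (2 * m) 0 = fallingFactorial (3 * u) m / (m.factorial : F) ∧
      c m (4 * m) 0 = fallingFactorial (5 * u) m / (m.factorial : F) := by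
    induction m, hm using Nat.le_induction with
    | base => simp [hc1, fallingFactorial]
    | succ m hm ih =>
      obtain ⟨ih0, ih2, ih4⟩ := ih
      have hfac : (m.factorial : F) ≠ 0 := Nat.cast_ne_zero.2 m.factorial_ne_zero
      have hdiv (w x y : F) (hx : x = fallingFactorial w m / (m.factorial : F))
          (hy : ((m : F) + 1) * y = (w - m) * x) :
          y = fallingFactorial w (m + 1) / ((m + 1).factorial : F) := by
        have := hne m
        rw [fallingFactorial_succ, Nat.factorial_succ]
        push_cast
        rw [eq_div_iff (mul_ne_zero this hfac), ← mul_assoc, mul_comm y, hy, hx]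
        field_simp
      refine ⟨hdiv _ _ _ ih0 ?_, hdiv _ _ _ ih2 ?_, hdiv _ _ _ ih4 ?_⟩
      · simp [hstep m hm]
      · rw [hstep m hm, if_pos (show 2 ≤ 2 * (m + 1) by omega), if_neg (show ¬1 ≤ 0 by omega),
          show 2 * (m + 1) - 2 = 2 * m by omega, hz m hm (2 * (m + 1) - 4) 0 (by omega)]
        simp only [mul_zero, ite_self]
        push_cast
        ring
      · rw [hstep m hm, if_pos (show 4 ≤ 4 * (m + 1) by omega), if_neg (show ¬1 ≤ 0 by omega),
          show 4 * (m + 1) - 4 = 4 * m by omega, hz m hm (4 * (m + 1) - 2) 0 (by omega)]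
        simp only [mul_zero, ite_self]
        push_cast
        ring
  refine ⟨hsupp, fun m hm => by simpa [hc] using hvert m hm, fun hu m hm => ?_⟩
  have hm1 : 1 ≤ m := by omega
  have hfac : (m.factorial : F) ≠ 0 := Nat.cast_ne_zero.2 m.factorial_ne_zero
  have hu1 (k : ℤ) : u ≠ k := by
    rintro rfl
    exact (hu (3 * k)).1 (by push_cast; rfl)
  obtain ⟨h0, h2, h4⟩ := hvert m hm1
  have n0 := h0.trans_ne (div_ne_zero (fallingFactorial_ne_zero hu1 m) hfac)
  have n2 := h2.trans_ne
    (div_ne_zero (fallingFactorial_ne_zero (fun k => (hu k).1) m) hfac)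
  have n4 := h4.trans_ne
    (div_ne_zero (fallingFactorial_ne_zero (fun k => (hu k).2) m) hfac)
  apply Set.Subset.antisymm
  · refine convexHull_min ?_ (convex_convexHull ℝ _)
    rintro _ ⟨d, hd, rfl⟩
    have hd' : Finsupp.single 0 (d 0) + Finsupp.single 1 (d 1) = d := by
      ext a
      fin_cases a <;> simp
    have hcd : c m (d 0) (d 1) ≠ 0 := by
      simp only [hc, hd']
      exact mem_support_iff.1 hd
    obtain ⟨l, r⟩ := hsupp m hm1 _ _ hcd
    exact mem_convexHull_D4_triangle (by exact_mod_cast hm1) (Nat.cast_nonneg _)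
      (by exact_mod_cast l) (by exact_mod_cast r)
  · apply convexHull_mono
    have hmem (i j : ℕ) (h : c m i j ≠ 0) : ((i : ℝ), (j : ℝ)) ∈
        (fun d : Fin 2 →₀ ℕ => (((d 0 : ℕ) : ℝ), ((d 1 : ℕ) : ℝ))) ''
          ((P m).support : Set (Fin 2 →₀ ℕ)) :=
      ⟨_, mem_support_iff.2 h, by simp⟩
    rintro _ (rfl | rfl | rfl)
    · simpa using hmem _ _ n0
    · simpa using hmem _ _ n2
    · simpa using hmem _ _ n4
end

section
/- Let F be a field of characteristic zero, let f = x^6 − s₁·x^4 + s₂·x^2 − 1 ∈ F[x, s₁, s₂], set u = 1/2 ∈ F, and let P_m ∈ F[x, s₁, s₂] (m ≥ 1) be the atomic inflection polynomials attached to (f, u) (with derivative taken in x). Then for every m ≥ 1, every monomial x^i·s₁^j·s₂^k occurring with nonzero coefficient in P_m satisfies i ≡ m (mod 2). Consequently, if m > 1 is odd then x divides P_m and P_m/x is a polynomial in x^2 (with coefficients in F[s₁, s₂]), while if m is even then P_m itself is a polynomial in x^2. -/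
open MvPolynomial

/-- A polynomial is homogeneous for the `ZMod 2`-weight recording the parity of the exponent of
`X i` exactly when all those exponents have the prescribed parity. -/
theorem isWeightedHomogeneous_single_one_iff_mod_two {σ R : Type*} [DecidableEq σ]
    [CommSemiring R] (i : σ) (p : MvPolynomial σ R) (m : ℕ) :
    IsWeightedHomogeneous (Pi.single i (1 : ZMod 2)) p (m : ZMod 2) ↔
      ∀ d ∈ p.support, d i % 2 = m % 2 := by
  simp only [IsWeightedHomogeneous, mem_support_iff, Finsupp.weight_single_index, nsmul_eq_mul,
    mul_one, ZMod.natCast_eq_natCast_iff']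

theorem isWeightedHomogeneous_of_C_mul {σ R M : Type*} [Field R] [AddCommMonoid M]
    {w : σ → M} {p : MvPolynomial σ R} {n : M} {c : R} (hc : c ≠ 0)
    (h : IsWeightedHomogeneous w (C c * p) n) : IsWeightedHomogeneous w p n := by
  intro d hd
  exact h (by rw [coeff_C_mul]; exact mul_ne_zero hc hd)

theorem X_dvd_of_forall_mem_support {σ R : Type*} [CommSemiring R] {i : σ}
    {p : MvPolynomial σ R} (h : ∀ d ∈ p.support, d i ≠ 0) : X i ∣ p := by
  rw [p.as_sum]
  exact Finset.dvd_sum fun d hd => X_dvd_monomial.mpr (Or.inr (h d hd))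

/-- The bielliptic sextic is even in `x`. -/
theorem isWeightedHomogeneous_bielliptic (R : Type*) [CommRing R] :
    IsWeightedHomogeneous (Pi.single 0 (1 : ZMod 2))
      (X 0 ^ 6 - X 1 * X 0 ^ 4 + X 2 * X 0 ^ 2 - 1 : MvPolynomial (Fin 3) R) 0 := by
  have hX (i : Fin 3) := isWeightedHomogeneous_X R (Pi.single (0 : Fin 3) (1 : ZMod 2)) i
  have h6 := (hX 0).pow 6
  have h4 := (hX 1).mul ((hX 0).pow 4)
  have h2 := (hX 2).mul ((hX 0).pow 2)
  exact ((h6.sub h4).add h2).sub (isWeightedHomogeneous_one R _)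

/-- For the atomic inflection polynomials of the bielliptic family
`y² = x⁶ - s₁x⁴ + s₂x² - 1` (so `u = 1/2`), every monomial `x^i s₁^j s₂^k` of `P_m`
satisfies `i ≡ m (mod 2)`; hence if `m > 1` is odd, `x ∣ P_m` and `P_m/x` is a
polynomial in `x²`, while if `m` is even, `P_m` itself is a polynomial in `x²`. -/
theorem bielliptic_inflection_parity
    (F : Type*) [Field F] [CharZero F]
    (f : MvPolynomial (Fin 3) F)
    (hf : f = X 0 ^ 6 - X 1 * X 0 ^ 4 + X 2 * X 0 ^ 2 - 1)
    (P : ℕ → MvPolynomial (Fin 3) F)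
    (hP1 : P 1 = C (1 / 2 : F) * pderiv 0 f)
    (hPrec : ∀ m : ℕ, 1 ≤ m →
      C ((m : F) + 1) * P (m + 1) =
        pderiv 0 (P m) * f + C ((1 / 2 : F) - (m : F)) * (P m * pderiv 0 f)) :
    ∀ m : ℕ, 1 ≤ m →
      (∀ d ∈ (P m).support, d 0 % 2 = m % 2) ∧
      (Odd m → 1 < m →
        X 0 ∣ P m ∧
        ∃ Q : MvPolynomial (Fin 3) F,
          P m = X 0 * Q ∧ ∀ d ∈ Q.support, d 0 % 2 = 0) ∧
      (Even m → ∀ d ∈ (P m).support, d 0 % 2 = 0) := by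
  set w : Fin 3 → ZMod 2 := Pi.single 0 1
  have hf0 : IsWeightedHomogeneous w f 0 := hf ▸ isWeightedHomogeneous_bielliptic F
  have hpd : IsWeightedHomogeneous w (pderiv 0 f) 1 := hf0.pderiv (by decide)
  have hP : ∀ m : ℕ, 1 ≤ m → IsWeightedHomogeneous w (P m) (m : ZMod 2) := by
    intro m hm
    induction m, hm using Nat.le_induction with
    | base => simpa only [hP1, Nat.cast_one] using hpd.C_mul _
    | succ m hm ih =>
      refine isWeightedHomogeneous_of_C_mul (Nat.cast_add_one_ne_zero m) ?_
      rw [hPrec m hm, Nat.cast_add, Nat.cast_one]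
      have hd : IsWeightedHomogeneous w (pderiv 0 (P m)) ((m : ZMod 2) + 1) :=
        ih.pderiv (by simp [w, add_assoc, CharTwo.add_self_eq_zero])
      have hdf := hd.mul hf0
      rw [add_zero] at hdf
      exact hdf.add ((ih.mul hpd).C_mul _)
  intro m hm
  have hpar := (isWeightedHomogeneous_single_one_iff_mod_two 0 (P m) m).mp (hP m hm)
  refine ⟨hpar, fun hodd _ => ?_, fun heven d hd => (hpar d hd).trans (Nat.even_iff.mp heven)⟩
  rw [Nat.odd_iff.mp hodd] at hpar
  have hdvd : X 0 ∣ P m := X_dvd_of_forall_mem_support fun d hd h0 => by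
    simpa [h0] using hpar d hd
  refine ⟨hdvd, ?_⟩
  obtain ⟨Q, hQ⟩ := hdvd
  refine ⟨Q, hQ, fun d hd => ?_⟩
  have hshift := hpar (Finsupp.single 0 1 + d) (by
    rwa [mem_support_iff, hQ, coeff_X_mul, ← mem_support_iff])
  rw [Finsupp.add_apply, Finsupp.single_eq_same] at hshift
  omega
end

section
/- For all integers n ≥ 2 and all natural numbers β, the following identity holds in ℚ: Σ_{j=1}^{n−1} (n−j)·(C(j,2)·β² + j·C(β,2)) + C(n−1,2)·β + (n−1)·β = ((n−1)·n²·(n+1)/24)·β² + ((n−1)·n·(5−n)/12)·β, where C(a,2) = a(a−1)/2 denotes the binomial coefficient. -/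
/-- The sum `∑_{j=1}^m (x - j)(C(j,2) b + j c)` in closed form. -/
lemma sum_Icc_sub_mul_choose_two_add (x b c : ℚ) (m : ℕ) :
    ∑ j ∈ Finset.Icc 1 m, (x - (j : ℚ)) * ((j : ℚ) * ((j : ℚ) - 1) / 2 * b + (j : ℚ) * c) =
      (x * ((m + 1) * m * (m - 1) / 6) -
        (m ^ 2 * (m + 1) ^ 2 / 8 - m * (m + 1) * (2 * m + 1) / 12)) * b +
      (x * (m * (m + 1) / 2) - m * (m + 1) * (2 * m + 1) / 6) * c := by
  induction m with
  | zero => simp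
  | succ k ih =>
    rw [Finset.sum_Icc_succ_top (by omega), ih]
    push_cast
    ring

/-- Closed-form evaluation of the local inflectionary multiplicity
`μ(B)` at a superelliptic ramification point:
`Σ_{j=1}^{n-1} (n-j)(C(j,2)β² + j·C(β,2)) + C(n-1,2)β + (n-1)β
  = ((n-1)n²(n+1)/24)β² + ((n-1)n(5-n)/12)β` in `ℚ`. -/
theorem superelliptic_inflectionary_multiplicity
    (n : ℕ) (hn : 2 ≤ n) (β : ℕ) :
    (∑ j ∈ Finset.Icc 1 (n - 1),
      ((n : ℚ) - (j : ℚ)) *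
        ((j : ℚ) * ((j : ℚ) - 1) / 2 * (β : ℚ) ^ 2 +
          (j : ℚ) * ((β : ℚ) * ((β : ℚ) - 1) / 2))) +
      ((n : ℚ) - 1) * ((n : ℚ) - 2) / 2 * (β : ℚ) + ((n : ℚ) - 1) * (β : ℚ) =
    ((n : ℚ) - 1) * (n : ℚ) ^ 2 * ((n : ℚ) + 1) / 24 * (β : ℚ) ^ 2 +
      ((n : ℚ) - 1) * (n : ℚ) * (5 - (n : ℚ)) / 12 * (β : ℚ) := by
  rw [sum_Icc_sub_mul_choose_two_add, Nat.cast_sub (by omega : 1 ≤ n)]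
  push_cast
  ring
end

section
/- Let α and β be natural numbers with α > β. Let N be the (β+1)×(β+1) integer matrix with rows indexed by i ∈ {0, …, β} and columns by j ∈ {0, …, β} whose (i, j) entry is the binomial coefficient C(2(α−β)+2j, 2(α−β)+i), and let M be the (β+1)×(β+1) integer matrix with rows indexed by w ∈ {0, …, β} and columns by v ∈ {0, …, β} whose (w, v) entry is C(α−β+v, 2v−w) when w ≤ 2v and 0 when w > 2v. Then det N = 2^{β(β+1)/2} · det M. -/
open Polynomial in
/-- The coefficients of `(X (X + 2)) ^ (d + v)` are, up to powers of two, the entries of the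
Gessel–Viennot matrix. -/
theorem two_pow_mul_coeff_X_mul_X_add_two_pow (d v w : ℕ) :
    2 ^ w * ((X * (X + C 2) : ℤ[X]) ^ (d + v)).coeff (2 * d + w) =
      4 ^ v * (if w ≤ 2 * v then ((d + v).choose (2 * v - w) : ℤ) else 0) := by
  rw [mul_pow, coeff_X_pow_mul', coeff_X_add_C_pow]
  split_ifs with h₁ h₂ h₂
  · rw [← Nat.choose_symm (n := d + v) (k := 2 * v - w) (by omega),
      show d + v - (2 * v - w) = 2 * d + w - (d + v) by omega,
      show d + v - (2 * d + w - (d + v)) = 2 * v - w by omega, ← mul_assoc, ← pow_add,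
      show w + (2 * v - w) = 2 * v by omega, pow_mul]
    norm_num
  · rw [Nat.choose_eq_zero_of_lt (by omega)]
    simp
  · rw [Nat.choose_eq_zero_of_lt (by omega)]
    simp
  · simp

open Polynomial in
/-- Expansion of `(1 + X) ^ (2 * n) = (1 + X * (X + 2)) ^ n` in powers of `X * (X + 2)`; the
terms of degree less than `2 * d` do not contribute to the coefficient of `X ^ (2 * d + i)`. -/
theorem choose_two_mul_eq_sum_coeff_mul_choose {d b i j : ℕ} (hj : j ≤ b) :
    ((2 * d + 2 * j).choose (2 * d + i) : ℤ) =
      ∑ k ∈ Finset.range (b + 1),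
        ((X * (X + C 2) : ℤ[X]) ^ (d + k)).coeff (2 * d + i) * ((d + j).choose (d + k) : ℤ) := by
  have hsq : (1 + X : ℤ[X]) ^ (2 * d + 2 * j) = (X * (X + C 2) + 1) ^ (d + j) := by
    rw [← mul_add, pow_mul]
    congr 1
    simp only [map_ofNat]
    ring
  have hlow : ∀ k ∈ Finset.range d,
      ((X * (X + C 2) : ℤ[X]) ^ k).coeff (2 * d + i) * ((d + j).choose k : ℤ) = 0 := by
    intro k hk
    rw [Finset.mem_range] at hk
    rw [mul_pow, coeff_X_pow_mul', if_pos (by omega), coeff_X_add_C_pow,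
      Nat.choose_eq_zero_of_lt (by omega)]
    simp
  rw [← coeff_one_add_X_pow ℤ, hsq, add_pow, finsetSum_coeff]
  simp only [one_pow, mul_one, coeff_mul_natCast]
  rw [add_assoc, Finset.sum_range_add, Finset.sum_eq_zero hlow, zero_add]
  refine Finset.sum_subset (Finset.range_mono (by omega)) fun k _ hk ↦ ?_
  rw [Finset.mem_range, not_lt] at hk
  rw [Nat.choose_eq_zero_of_lt (by omega)]
  simp


/-- The Vandermonde-type determinant `det N(2, β, 2α)` equals
`2^{C(β+1,2)}` times the Gessel–Viennot determinant `det M(α, β)` from the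
hyperelliptic (`n = 2`) case. -/
theorem vandermonde_vs_gessel_viennot
    (α β : ℕ) (h : β < α) :
    (Matrix.of fun i j : Fin (β + 1) =>
        ((2 * (α - β) + 2 * (j : ℕ)).choose (2 * (α - β) + (i : ℕ)) : ℤ)).det =
    2 ^ (β * (β + 1) / 2) *
      (Matrix.of fun w v : Fin (β + 1) =>
        if (w : ℕ) ≤ 2 * (v : ℕ) then
          ((α - β + (v : ℕ)).choose (2 * (v : ℕ) - (w : ℕ)) : ℤ)
        else 0).det := by
  generalize α - β = d
  let P : Matrix (Fin (β + 1)) (Fin (β + 1)) ℤ := Matrix.of fun i j ↦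
    ((.X * (.X + .C 2) : Polynomial ℤ) ^ (d + (j : ℕ))).coeff (2 * d + (i : ℕ))
  let U : Matrix (Fin (β + 1)) (Fin (β + 1)) ℤ :=
    Matrix.of fun i j ↦ ((d + (j : ℕ)).choose (d + (i : ℕ)) : ℤ)
  have hU : U.det = 1 := by
    rw [Matrix.det_of_isUpperTriangular]
    · simp [U]
    · intro i j hij
      have : (j : ℕ) < i := hij
      simp [U, Nat.choose_eq_zero_of_lt (Nat.add_lt_add_left this d)]
  have hN : (Matrix.of fun i j : Fin (β + 1) ↦
      ((2 * d + 2 * (j : ℕ)).choose (2 * d + (i : ℕ)) : ℤ)) = P * U := by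
    ext i j
    rw [Matrix.mul_apply, Matrix.of_apply,
      choose_two_mul_eq_sum_coeff_mul_choose (Nat.le_of_lt_succ j.isLt), Finset.sum_range]
    rfl
  have hprod (a : ℤ) : ∏ i : Fin (β + 1), a ^ (i : ℕ) = a ^ (β * (β + 1) / 2) := by
    rw [Finset.prod_pow_eq_pow_sum, Fin.sum_univ_eq_sum_range (fun i ↦ i), Finset.sum_range_id,
      Nat.add_sub_cancel, mul_comm]
  rw [hN, Matrix.det_mul, hU, mul_one]
  refine mul_left_cancel₀ (pow_ne_zero (β * (β + 1) / 2) (two_ne_zero (α := ℤ))) ?_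
  rw [← mul_assoc, ← mul_pow, ← hprod, ← hprod, ← Matrix.det_mul_column, ← Matrix.det_mul_row]
  congr 1
  ext w v
  simpa [P] using two_pow_mul_coeff_X_mul_X_add_two_pow d v w
end

section
/- Let F be a field of characteristic zero, let f = x^6 + x^3 + z ∈ F[x, z], and let P_m ∈ F[x, z] (m ≥ 1) be the atomic inflection polynomials attached to (f, u) with u = 1/2 (derivative taken in x). Then for every ζ ∈ F with ζ³ = 1 and every m ≥ 1, the image of P_m under the F-algebra endomorphism of F[x, z] sending x to ζ·x and fixing z equals ζ^{2m}·P_m. In particular, (x, z) ↦ (ζx, z) defines a cyclic μ₃-symmetry of each inflectionary curve (P_m = 0) derived from the D₆ pencil y^n = x^6 + x^3 + z. -/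
open MvPolynomial

/-- Chain rule for the substitution rescaling the first variable by a constant. -/
theorem pderiv_zero_map_of_scale {R : Type*} [CommSemiring R] {c : R}
    {φ : MvPolynomial (Fin 2) R →ₐ[R] MvPolynomial (Fin 2) R}
    (h0 : φ (X 0) = C c * X 0) (h1 : φ (X 1) = X 1) (p : MvPolynomial (Fin 2) R) :
    pderiv 0 (φ p) = C c * φ (pderiv 0 p) := by
  induction p using MvPolynomial.induction_on with
  | C a => simp [← algebraMap_eq]
  | add p q hp hq => simp only [map_add, hp, hq, mul_add]
  | mul_X p i hp =>
    simp only [map_mul, Derivation.leibniz, smul_eq_mul, map_add, hp]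
    fin_cases i
    · simp [h0, Derivation.leibniz]
      ring
    · simp [h1]
      ring

/-- The inflection polynomials of the D₆ pencil
`y^n = x^6 + x^3 + z` (with `u = 1/2`) satisfy `P_m(ζx, z) = ζ^{2m} · P_m(x, z)`
for any cube root of unity `ζ`: the inflectionary curves carry a μ₃-symmetry
`(x, z) ↦ (ζx, z)`. -/
theorem D6_inflectionary_mu3_symmetry
    (F : Type*) [Field F] [CharZero F]
    (f : MvPolynomial (Fin 2) F)
    (hf : f = X 0 ^ 6 + X 0 ^ 3 + X 1)
    (P : ℕ → MvPolynomial (Fin 2) F)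
    (hP1 : P 1 = C (1 / 2 : F) * pderiv 0 f)
    (hPrec : ∀ m : ℕ, 1 ≤ m →
      C ((m : F) + 1) * P (m + 1) =
        pderiv 0 (P m) * f + C ((1 / 2 : F) - (m : F)) * (P m * pderiv 0 f)) :
    ∀ ζ : F, ζ ^ 3 = 1 → ∀ m : ℕ, 1 ≤ m →
      aeval ![C ζ * X 0, X 1] (P m) = C (ζ ^ (2 * m)) * P m := by
  intro ζ hζ m hm
  suffices H : ∀ φ : MvPolynomial (Fin 2) F →ₐ[F] MvPolynomial (Fin 2) F,
      φ (X 0) = C ζ * X 0 → φ (X 1) = X 1 → φ (P m) = C (ζ ^ (2 * m)) * P m from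
    H _ (by simp) (by simp)
  intro φ h0 h1
  have hφC (a : F) : φ (C a) = C a := by simpa only [algebraMap_eq] using φ.commutes a
  have hC : (C ζ : MvPolynomial (Fin 2) F) ^ 3 = 1 := by rw [← C_pow, hζ, C_1]
  have hC0 : (C ζ : MvPolynomial (Fin 2) F) ≠ 0 := by
    intro h
    simp [h] at hC
  have hf_inv : φ f = f := by
    simp only [hf, map_add, map_pow, h0, h1]
    linear_combination ((C ζ ^ 3 + 1) * X 0 ^ 6 + X 0 ^ 3) * hC
  have map_pderiv : ∀ (k : ℕ) (p : MvPolynomial (Fin 2) F),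
      φ p = C (ζ ^ k) * p →
      φ (pderiv 0 p) = C (ζ ^ (k + 2)) * pderiv 0 p := by
    intro k p hp
    have h := pderiv_zero_map_of_scale h0 h1 p
    rw [hp, pderiv_C_mul] at h
    apply mul_left_cancel₀ hC0
    rw [← h]
    simp only [C_pow]
    linear_combination (-C ζ ^ k * pderiv 0 p) * hC
  have hf_deriv := map_pderiv 0 f (by simpa using hf_inv)
  induction m, hm using Nat.le_induction with
  | base =>
    rw [hP1, map_mul, hf_deriv, hφC]
    simp only [C_pow]
    ring
  | succ m hm ih =>
    have hm0 : (C ((m : F) + 1) : MvPolynomial (Fin 2) F) ≠ 0 :=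
      C_ne_zero.mpr (Nat.cast_add_one_ne_zero m)
    have hP_deriv := map_pderiv _ _ ih
    have h := congrArg φ (hPrec m hm)
    simp only [map_mul, map_add φ, hφC, hf_inv, hf_deriv, hP_deriv,
      ih] at h
    apply mul_left_cancel₀ hm0
    rw [h]
    simp only [C_pow]
    linear_combination (-C ζ ^ (2 * m + 2)) * hPrec m hm
end

section
/- Let F be a field of characteristic zero, u ∈ F, and let f ∈ F[x] be a monic polynomial of degree D ≥ 1. Define P_m ∈ F[x] (m ≥ 1) recursively by P_1 = u·f′ and (m+1)·P_{m+1} = P_m′·f + (u − m)·P_m·f′. Then for every m ≥ 1, the degree of P_m is at most m·(D−1), and the coefficient of x^{m(D−1)} in P_m equals (Du)_m/m!, where Du denotes D·u ∈ F. -/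
open Polynomial

theorem natDegree_derivative_mul_le {R : Type*} [CommRing R] {p q : R[X]} {n d : ℕ}
    (hp : p.natDegree ≤ n) (hq : q.natDegree ≤ d + 1) :
    (derivative p * q).natDegree ≤ n + d := by
  cases n with
  | zero => simp [derivative_of_natDegree_zero (Nat.le_zero.mp hp)]
  | succ k =>
    have hp' : (derivative p).natDegree ≤ k := (natDegree_derivative_le p).trans (by omega)
    exact (natDegree_mul_le_of_le hp' hq).trans (by omega)

theorem coeff_derivative_mul_of_natDegree_le {R : Type*} [CommRing R] {p q : R[X]} {n d : ℕ}
    (hp : p.natDegree ≤ n) (hq : q.natDegree ≤ d + 1) :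
    (derivative p * q).coeff (n + d) = n * p.coeff n * q.coeff (d + 1) := by
  cases n with
  | zero => simp [derivative_of_natDegree_zero (Nat.le_zero.mp hp)]
  | succ k =>
    have hp' : (derivative p).natDegree ≤ k := (natDegree_derivative_le p).trans (by omega)
    rw [show k + 1 + d = k + (d + 1) by omega, coeff_mul_add_eq_of_natDegree_le hp' hq,
      coeff_derivative]
    push_cast
    ring

/-- For a monic `f` of degree `D ≥ 1`, the atomic inflection
polynomial `P_m` has degree at most `m(D-1)` and its coefficient in degree
`m(D-1)` equals `(Du)_m / m!`. -/
theorem inflection_polynomial_leading_coefficient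
    (F : Type*) [Field F] [CharZero F]
    (u : F) (D : ℕ) (hD : 1 ≤ D)
    (f : F[X]) (hmonic : f.Monic) (hdeg : f.natDegree = D)
    (P : ℕ → F[X])
    (hP1 : P 1 = C u * derivative f)
    (hPrec : ∀ m : ℕ, 1 ≤ m →
      C ((m : F) + 1) * P (m + 1) =
        derivative (P m) * f + C (u - (m : F)) * (P m * derivative f)) :
    ∀ m : ℕ, 1 ≤ m →
      (P m).degree ≤ (m * (D - 1) : ℕ) ∧
      (P m).coeff (m * (D - 1)) =
        fallingFactorial ((D : F) * u) m / (m.factorial : F) := by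
  obtain ⟨d, rfl⟩ : ∃ d, D = d + 1 := ⟨D - 1, by omega⟩
  have hlead : f.coeff (d + 1) = 1 := hdeg ▸ hmonic.coeff_natDegree
  have hf' : (derivative f).natDegree ≤ d := (natDegree_derivative_le f).trans (by omega)
  have hf'_coeff : (derivative f).coeff d = (d : F) + 1 := by
    rw [coeff_derivative, hlead, one_mul]
  simp only [Nat.add_sub_cancel, ← natDegree_le_iff_degree_le]
  intro m hm
  induction m, hm using Nat.le_induction with
  | base =>
    refine ⟨?_, ?_⟩
    · rw [hP1, one_mul]
      exact (natDegree_C_mul_le _ _).trans hf'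
    · simp [hP1, fallingFactorial, hf'_coeff, mul_comm]
  | succ m hm ih =>
    obtain ⟨ih_deg, ih_coeff⟩ := ih
    have hne : (m : F) + 1 ≠ 0 := Nat.cast_add_one_ne_zero m
    have hfac : (m.factorial : F) ≠ 0 := Nat.cast_ne_zero.mpr m.factorial_ne_zero
    have hrec := hPrec m hm
    rw [Nat.succ_mul]
    refine ⟨?_, ?_⟩
    · rw [← natDegree_C_mul hne, hrec]
      exact natDegree_add_le_of_degree_le (natDegree_derivative_mul_le ih_deg hdeg.le)
        ((natDegree_C_mul_le _ _).trans (natDegree_mul_le_of_le ih_deg hf'))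
    · have h := congrArg (fun p => coeff p (m * d + d)) hrec
      simp only [coeff_add, coeff_C_mul, coeff_derivative_mul_of_natDegree_le ih_deg hdeg.le,
        coeff_mul_add_eq_of_natDegree_le ih_deg hf', hlead, hf'_coeff, ih_coeff] at h
      apply mul_left_cancel₀ hne
      rw [h, fallingFactorial, fallingFactorial, Finset.prod_range_succ, Nat.factorial_succ]
      push_cast
      field_simp
      ring
end
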